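/- Let Y ⊂ ℙᴺ be an irreducible cubic hypersurface that is not a cone, with smooth singular locus Y', and suppose Y = S(Y₁,Y₂) is the join of two disjoint irreducible components Y₁, Y₂ of Y' with a general point of Y lying on a unique secant line ⟨y₁,y₂⟩ (y₁ ∈ Y₁, y₂ ∈ Y₂). Then deg Y₁ · deg Y₂ = 3, so one of Y₁, Y₂ is a linear subspace, contradicting that Y is not a cone. Hence Y cannot be such a join; i.e. there is a single irreducible component Y₀' of Y' with Y = SY₀'. -/

import Mathlib

/-!
STATEMENT 18: Let `Y ⊂ ℙᴺ` be an irreducible cubic hypersurface that is not a cone,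
with smooth singular locus `Y'`, and suppose `Y = S(Y₁,Y₂)` is the join of two disjoint
irreducible components `Y₁, Y₂` of `Y'`, a general point of `Y` lying on a unique
secant line `⟨y₁,y₂⟩` (`y₁ ∈ Y₁`, `y₂ ∈ Y₂`).  This situation is impossible (one would
get `deg Y₁ · deg Y₂ = deg Y = 3`, so one of `Y₁, Y₂` would be linear and `Y` a cone);
hence `Y` cannot be such a join — so that when `Y = SY'` there must be a single
irreducible component `Y₀'` of `Y'` with `Y = SY₀'`.
Phrased on affine cones in `ℂ^{N+1}`; `Y' = Sing Y` is the common zero locus of the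
partial derivatives of the cubic `F`; smoothness of the two components is expressed by
the Zariski tangent spaces having the expected dimension at nonzero points; "general"
means off the zero locus of some nonzero polynomial.  The conclusion is `False`.
-/

open MvPolynomial

def zcl {σ : Type*} (S : Set (σ → ℂ)) : Set (σ → ℂ) :=
  {x | ∀ p : MvPolynomial σ ℂ, (∀ y ∈ S, eval y p = 0) → eval x p = 0}

def ZClosed {σ : Type*} (S : Set (σ → ℂ)) : Prop := zcl S = S

def ZIrr {σ : Type*} (S : Set (σ → ℂ)) : Prop :=
  S.Nonempty ∧ ∀ C₁ C₂ : Set (σ → ℂ), ZClosed C₁ → ZClosed C₂ →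
    S ⊆ C₁ ∪ C₂ → (S ⊆ C₁ ∨ S ⊆ C₂)

noncomputable def adim {σ : Type*} (S : Set (σ → ℂ)) : WithBot ℕ∞ :=
  Order.krullDim {T : Set (σ → ℂ) // ZIrr T ∧ ZClosed T ∧ T ⊆ S}

def ztang {n : ℕ} (S : Set (Fin n → ℂ)) (y : Fin n → ℂ) : Set (Fin n → ℂ) :=
  {u | ∀ p : MvPolynomial (Fin n) ℂ, (∀ x ∈ S, eval x p = 0) →
    (∑ i, u i * eval y (pderiv i p)) = 0}

/-- Polynomial implications valid at complex points hold at points of any extension field. -/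
theorem nullstellensatz_transfer {τ Ω : Type*} [Finite τ] [Field Ω] [Algebra ℂ Ω]
    (S : Set (MvPolynomial τ ℂ)) (f : MvPolynomial τ ℂ)
    (hf : ∀ a : τ → ℂ, (∀ p ∈ S, eval a p = 0) → eval a f = 0)
    (ω : τ → Ω) (hω : ∀ p ∈ S, aeval ω p = 0) : aeval ω f = 0 := by
  have h : f ∈ (Ideal.span S).radical := by
    rw [← vanishingIdeal_zeroLocus_eq_radical (K := ℂ), zeroLocus_span]
    intro a ha
    simpa [MvPolynomial.aeval_eq_eval] using hf a (by simpa [MvPolynomial.aeval_eq_eval] using ha)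
  obtain ⟨n, hn⟩ := h
  have hle : Ideal.span S ≤ RingHom.ker (aeval ω : MvPolynomial τ ℂ →ₐ[ℂ] Ω) :=
    Ideal.span_le.2 fun p hp => hω p hp
  have := hle hn
  rw [RingHom.mem_ker, map_pow] at this
  exact IsReduced.eq_zero _ ⟨n, this⟩

theorem zclosed_zeros {σ : Type*} (P : Set (MvPolynomial σ ℂ)) :
    ZClosed {a : σ → ℂ | ∀ p ∈ P, eval a p = 0} := by
  apply Set.Subset.antisymm
  · intro a ha p hp
    exact ha p fun y hy => hy p hp
  · intro a ha p hp
    exact hp a ha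

theorem ZIrr.mul_vanish {σ : Type*} {S : Set (σ → ℂ)} (hS : ZIrr S) {ι κ : Type*}
    (f : ι → MvPolynomial σ ℂ) (g : κ → MvPolynomial σ ℂ)
    (h : ∀ a ∈ S, (∀ i, eval a (f i) = 0) ∨ (∀ j, eval a (g j) = 0)) :
    (∀ a ∈ S, ∀ i, eval a (f i) = 0) ∨ (∀ a ∈ S, ∀ j, eval a (g j) = 0) := by
  have := hS.2 _ _ (zclosed_zeros (Set.range f)) (zclosed_zeros (Set.range g))
    (fun a ha => by simpa using h a ha)
  simpa [Set.subset_def] using this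

theorem zirr_of_mul {σ : Type*} {S : Set (σ → ℂ)} (hne : S.Nonempty)
    (h : ∀ f g : MvPolynomial σ ℂ, (∀ a ∈ S, eval a (f * g) = 0) →
      (∀ a ∈ S, eval a f = 0) ∨ (∀ a ∈ S, eval a g = 0)) : ZIrr (zcl S) := by
  have hsub : S ⊆ zcl S := fun a ha p hp => hp a ha
  refine ⟨hne.mono hsub, fun C₁ C₂ h₁ h₂ hc => ?_⟩
  by_contra! hcon
  have key : ∀ C : Set (σ → ℂ), ZClosed C → ¬ zcl S ⊆ C →
      ∃ f : MvPolynomial σ ℂ, (∀ a ∈ C, eval a f = 0) ∧ ∃ a ∈ S, eval a f ≠ 0 := by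
    intro C hC hn
    by_contra! hall
    apply hn
    intro a ha
    rw [← hC]
    intro p hp
    exact ha p fun y hy => hall p hp y hy
  obtain ⟨f, hf, a, ha, hfa⟩ := key C₁ h₁ hcon.1
  obtain ⟨g, hg, b, hb, hgb⟩ := key C₂ h₂ hcon.2
  rcases h f g (fun x hx => by
    rcases hc (hsub hx) with h | h
    · simp [hf x h]
    · simp [hg x h]) with h | h
  · exact hfa (h a ha)
  · exact hgb (h b hb)

theorem eval_add_smul_poly {σ : Type*} (p : MvPolynomial σ ℂ) (y v : σ → ℂ) (t : ℂ) :
    (aeval (fun i => Polynomial.C (y i) + Polynomial.X * Polynomial.C (v i)) p).eval t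
      = eval (y + t • v) p := by
  rw [← Polynomial.coe_aeval_eq_eval, MvPolynomial.comp_aeval_apply, ← MvPolynomial.aeval_eq_eval]
  congr 2
  ext i
  simp
  exact mul_comm _ _

theorem ZIrr.zcl_cone {σ : Type*} {S : Set (σ → ℂ)} (hS : ZIrr S) :
    ZIrr (zcl {w | ∃ y ∈ S, ∃ t : ℂ, w = t • y}) := by
  obtain ⟨y₀, hy₀⟩ := hS.1
  refine zirr_of_mul ⟨_, y₀, hy₀, 1, rfl⟩ fun f g hfg => ?_
  have hdil : ∀ (p : MvPolynomial σ ℂ) (t : ℂ) (y : σ → ℂ),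
      eval y (aeval (fun i => C t * X i) p) = eval (t • y) p := by
    intro p t y
    rw [MvPolynomial.aeval_def, MvPolynomial.hom_eval₂, ← MvPolynomial.eval₂_id]
    congr 1
    · ext; simp
    · ext i; simp
  let L (y : σ → ℂ) (i : σ) : Polynomial ℂ := Polynomial.C ((0 : σ → ℂ) i) +
    Polynomial.X * Polynomial.C (y i)
  have hL : ∀ (p : MvPolynomial σ ℂ) (t : ℂ) (y : σ → ℂ),
      (aeval (L y) p).eval t = eval (t • y) p := by
    intro p t y
    rw [eval_add_smul_poly, zero_add]
  have := hS.mul_vanish (fun t : ℂ => aeval (fun i => C t * X i) f)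
    (fun t : ℂ => aeval (fun i => C t * X i) g) (by
      intro y hy
      simp only [hdil]
      set a := aeval (L y) f
      set b := aeval (L y) g
      have hab : a * b = 0 := by
        apply Polynomial.funext
        intro t
        have := hfg (t • y) ⟨y, hy, t, rfl⟩
        simpa [a, b, hL] using this
      rcases mul_eq_zero.1 hab with h | h
      · left; intro t
        have := congrArg (Polynomial.eval t) h
        rwa [hL, Polynomial.eval_zero] at this
      · right; intro t
        have := congrArg (Polynomial.eval t) h
        rwa [hL, Polynomial.eval_zero] at this)
  simp only [hdil] at this
  rcases this with h | h
  · left; rintro _ ⟨y, hy, t, rfl⟩; exact h y hy t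
  · right; rintro _ ⟨y, hy, t, rfl⟩; exact h y hy t

/-- An irreducible component of a closed cone is a cone. -/
theorem ZIrr.smul_mem_of_maximal {σ : Type*} {Y Z : Set (σ → ℂ)} (hY : ZIrr Y)
    (hZ : ZClosed Z) (hcone : ∀ z ∈ Z, ∀ t : ℂ, t • z ∈ Z) (hsub : Y ⊆ Z)
    (hmax : ∀ T, ZIrr T → ZClosed T → Y ⊆ T → T ⊆ Z → T = Y) :
    ∀ y ∈ Y, ∀ t : ℂ, t • y ∈ Y := by
  set S := {w | ∃ y ∈ Y, ∃ t : ℂ, w = t • y}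
  have hS : S ⊆ zcl S := fun a ha p hp => hp a ha
  have h : zcl S = Y := by
    refine hmax _ hY.zcl_cone ?_ ?_ ?_
    · apply Set.Subset.antisymm
      · intro a ha p hp
        exact ha p fun y hy => hy p hp
      · exact fun a ha p hp => hp a ha
    · exact fun y hy => hS ⟨y, hy, 1, by simp⟩
    · intro a ha
      rw [← hZ]
      intro p hp
      refine ha p ?_
      rintro _ ⟨y, hy, t, rfl⟩
      exact hp _ (hcone _ (hsub hy) t)
  intro y hy t
  rw [← h]
  exact hS ⟨y, hy, t, rfl⟩

theorem isPrime_vanishingIdeal_prod {σ τ : Type*} {Y₁ : Set (σ → ℂ)} {Y₂ : Set (τ → ℂ)}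
    (h₁ : ZIrr Y₁) (h₂ : ZIrr Y₂) :
    (vanishingIdeal ℂ {c : σ ⊕ τ → ℂ | ∃ a ∈ Y₁, ∃ b ∈ Y₂, c = Sum.elim a b}).IsPrime := by
  have hr : ∀ (p : MvPolynomial (σ ⊕ τ) ℂ) (a : σ → ℂ) (b : τ → ℂ),
      eval b (aeval (Sum.elim (fun i => C (a i)) X) p) = eval (Sum.elim a b) p := by
    intro p a b
    rw [← MvPolynomial.aeval_eq_eval, MvPolynomial.comp_aeval_apply, ← MvPolynomial.aeval_eq_eval]
    congr 2
    ext i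
    cases i <;> simp
  have hl : ∀ (p : MvPolynomial (σ ⊕ τ) ℂ) (a : σ → ℂ) (b : τ → ℂ),
      eval a (aeval (Sum.elim X (fun i => C (b i))) p) = eval (Sum.elim a b) p := by
    intro p a b
    rw [← MvPolynomial.aeval_eq_eval, MvPolynomial.comp_aeval_apply, ← MvPolynomial.aeval_eq_eval]
    congr 2
    ext i
    cases i <;> simp
  rw [Ideal.isPrime_iff]
  constructor
  · obtain ⟨a, ha⟩ := h₁.1
    obtain ⟨b, hb⟩ := h₂.1
    rw [Ideal.ne_top_iff_one, mem_vanishingIdeal_iff]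
    intro h
    simpa using h _ ⟨a, ha, b, hb, rfl⟩
  · intro f g hfg
    simp only [mem_vanishingIdeal_iff, MvPolynomial.aeval_eq_eval] at hfg ⊢
    have := h₁.mul_vanish (fun b : Y₂ => aeval (Sum.elim X (fun i => C (b.1 i))) f)
      (fun b : Y₂ => aeval (Sum.elim X (fun i => C (b.1 i))) g) (by
        intro a ha
        have := h₂.mul_vanish (fun _ : Unit => aeval (Sum.elim (fun i => C (a i)) X) f)
          (fun _ : Unit => aeval (Sum.elim (fun i => C (a i)) X) g) (by
            intro b hb
            have := hfg _ ⟨a, ha, b, hb, rfl⟩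
            simpa only [hr, forall_const, map_mul, mul_eq_zero] using this)
        simpa only [hr, hl, forall_const, Subtype.forall] using this)
    simp only [hl, Subtype.forall] at this
    rcases this with h | h
    · left; rintro _ ⟨a, ha, b, hb, rfl⟩; exact h a ha b hb
    · right; rintro _ ⟨a, ha, b, hb, rfl⟩; exact h a ha b hb

/-- The product of two irreducible sets has a generic point generating its function field. -/
theorem exists_generic_point {σ τ : Type} {Y₁ : Set (σ → ℂ)} {Y₂ : Set (τ → ℂ)}
    (h₁ : ZIrr Y₁) (h₂ : ZIrr Y₂) :
    ∃ (K : Type) (_ : Field K) (_ : Algebra ℂ K) (y : σ → K) (z : τ → K),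
      (∀ p : MvPolynomial (σ ⊕ τ) ℂ, aeval (Sum.elim y z) p = 0 ↔
        ∀ a ∈ Y₁, ∀ b ∈ Y₂, eval (Sum.elim a b) p = 0) ∧
      IntermediateField.adjoin ℂ (Set.range y ∪ Set.range z) = ⊤ := by
  set I := vanishingIdeal ℂ {c : σ ⊕ τ → ℂ | ∃ a ∈ Y₁, ∃ b ∈ Y₂, c = Sum.elim a b} with hI
  have : I.IsPrime := isPrime_vanishingIdeal_prod h₁ h₂
  let A := MvPolynomial (σ ⊕ τ) ℂ ⧸ I
  let K := FractionRing A
  let η : σ ⊕ τ → K := fun i => algebraMap A K (Ideal.Quotient.mk I (X i))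
  have hη : ∀ p, aeval η p = algebraMap A K (Ideal.Quotient.mk I p) := by
    intro p
    have : aeval η = ((IsScalarTower.toAlgHom ℂ A K).comp (Ideal.Quotient.mkₐ ℂ I)) := by
      ext i
      simp [η]
      rfl
    rw [this]
    rfl
  refine ⟨K, inferInstance, inferInstance, η ∘ Sum.inl, η ∘ Sum.inr, ?_, ?_⟩
  · intro p
    rw [Sum.elim_comp_inl_inr, hη, map_eq_zero_iff _ (IsFractionRing.injective A K),
      Ideal.Quotient.eq_zero_iff_mem, hI, mem_vanishingIdeal_iff]
    simp only [MvPolynomial.aeval_eq_eval]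
    constructor
    · exact fun h a ha b hb => h _ ⟨a, ha, b, hb, rfl⟩
    · rintro h _ ⟨a, ha, b, hb, rfl⟩
      exact h a ha b hb
  · rw [eq_top_iff]
    rintro x -
    rw [← Set.Sum.elim_range, Sum.elim_comp_inl_inr]
    obtain ⟨a, b, -, rfl⟩ := IsFractionRing.div_surjective (A := A) x
    obtain ⟨p, rfl⟩ := Ideal.Quotient.mk_surjective a
    obtain ⟨q, rfl⟩ := Ideal.Quotient.mk_surjective b
    rw [← hη, ← hη, IntermediateField.mem_adjoin_range_iff]
    exact ⟨p, q, rfl⟩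

theorem natDegree_aeval_le_and_coeff {σ B : Type*} [CommRing B] [Algebra ℂ B]
    (f : σ → Polynomial B) {d : ℕ} (hd : 0 < d) (hf : ∀ i, (f i).natDegree ≤ d)
    (G : MvPolynomial σ ℂ) {e : ℕ} (hG : G.totalDegree ≤ e) :
    (aeval f G).natDegree ≤ d * e ∧
      (aeval f G).coeff (d * e) = aeval (fun i => (f i).coeff d) (homogeneousComponent e G) := by
  have hmon : ∀ m : σ →₀ ℕ, (m.prod fun i k => f i ^ k).natDegree ≤ d * m.degree ∧
      (m.prod fun i k => f i ^ k).coeff (d * m.degree) =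
        m.prod fun i k => (f i).coeff d ^ k := by
    intro m
    induction m using Finsupp.induction_linear with
    | zero => simp
    | add a b ha hb =>
      rw [Finsupp.prod_add_index' (by simp) (by simp [pow_add]),
        Finsupp.prod_add_index' (by simp) (by simp [pow_add]), map_add, mul_add]
      exact ⟨Polynomial.natDegree_mul_le_of_le ha.1 hb.1, by
        rw [Polynomial.coeff_mul_add_eq_of_natDegree_le ha.1 hb.1, ha.2, hb.2]⟩
    | single i k =>
      rw [Finsupp.prod_single_index (by simp), Finsupp.prod_single_index (by simp),
        Finsupp.degree_single, mul_comm d k]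
      exact ⟨Polynomial.natDegree_pow_le_of_le k (hf i),
        Polynomial.coeff_pow_of_natDegree_le (hf i)⟩
  have hexp : aeval f G = ∑ m ∈ G.support, algebraMap ℂ (Polynomial B) (coeff m G) *
      m.prod fun i k => f i ^ k := by
    conv_lhs => rw [G.as_sum]
    rw [map_sum]
    exact Finset.sum_congr rfl fun m _ => aeval_monomial _ _ _
  have hle : ∀ m ∈ G.support, m.degree ≤ e := fun m hm => by
    refine le_trans ?_ hG
    exact le_totalDegree hm
  rw [hexp]
  constructor
  · refine Polynomial.natDegree_sum_le_of_forall_le _ _ fun m hm => ?_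
    rw [← Algebra.smul_def]
    exact (Polynomial.natDegree_smul_le _ _).trans
      ((hmon m).1.trans (Nat.mul_le_mul_left _ (hle m hm)))
  · rw [Polynomial.finsetSum_coeff, homogeneousComponent_apply, map_sum, Finset.sum_filter]
    refine Finset.sum_congr rfl fun m hm => ?_
    rw [← Algebra.smul_def, Polynomial.coeff_smul]
    split_ifs with h
    · rw [← h, (hmon m).2, aeval_monomial, Algebra.smul_def]
    · rw [Polynomial.coeff_eq_zero_of_natDegree_lt, smul_zero]
      exact (hmon m).1.trans_lt (Nat.mul_lt_mul_of_pos_left (lt_of_le_of_ne (hle m hm) h) hd)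

theorem homogeneousComponent_totalDegree_ne_zero {σ R : Type*} [CommSemiring R]
    {p : MvPolynomial σ R} (hp : p ≠ 0) : homogeneousComponent p.totalDegree p ≠ 0 := by
  obtain ⟨m, hm, hmd⟩ := Finset.exists_mem_eq_sup p.support (support_nonempty.2 hp)
    (fun s => s.sum fun _ k => k)
  intro h
  have := congrArg (coeff m) h
  rw [coeff_homogeneousComponent, if_pos (show m.degree = p.totalDegree from hmd.symm),
    coeff_zero] at this
  exact mem_support_iff.1 hm this

theorem MvPolynomial.IsHomogeneous.eval_mul_left {σ : Type*} {e : ℕ} {p : MvPolynomial σ ℂ}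
    (hp : p.IsHomogeneous e) (r : ℂ) (x : σ → ℂ) :
    eval (fun i => r * x i) p = r ^ e * eval x p := by
  rw [eval_eq, eval_eq, Finset.mul_sum]
  refine Finset.sum_congr rfl fun m hm => ?_
  simp_rw [mul_pow, Finset.prod_mul_distrib, Finset.prod_pow_eq_pow_sum]
  rw [show ∑ i ∈ m.support, m i = e from hp.degree_eq_sum_deg_support hm ▸ rfl]
  ring

theorem isIntegralElem_of_relation {K : Type*} [Field K] [Algebra ℂ K] {D : ℕ} {s : Fin D → K}
    {x : K} (c : Option (Fin D) → ℂ)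
    (G : MvPolynomial (Option (Fin D)) ℂ)
    (hG : aeval (fun o : Option (Fin D) =>
      o.elim (c none • x) (fun j => s j + c (some j) • x)) G = 0)
    (hc : eval c (homogeneousComponent G.totalDegree G) ≠ 0) :
    (aeval s : MvPolynomial (Fin D) ℂ →ₐ[ℂ] K).toRingHom.IsIntegralElem x := by
  set e := G.totalDegree with he
  let P := MvPolynomial (Fin D) ℂ
  let φ : P →ₐ[ℂ] K := aeval s
  let f : Option (Fin D) → Polynomial P := fun o =>
    o.elim (Polynomial.C (C (c none)) * Polynomial.X)
      (fun j => Polynomial.C (X j) + Polynomial.C (C (c (some j))) * Polynomial.X)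
  have hf : ∀ o, (f o).natDegree ≤ 1 := by
    rintro (_ | j) <;> simp only [f, Option.elim] <;> compute_degree
  have hfc : ∀ o, (f o).coeff 1 = algebraMap ℂ P (c o) := by
    rintro (_ | j) <;> simp [f, Polynomial.coeff_C] <;> rfl
  obtain ⟨h₁, h₂⟩ := natDegree_aeval_le_and_coeff f one_pos hf G le_rfl
  rw [← he] at h₁ h₂
  set g := aeval f G with hg
  have hlead : g.coeff (1 * e) = algebraMap ℂ P (eval c (homogeneousComponent e G)) := by
    rw [h₂]
    simp_rw [hfc]
    exact (MvPolynomial.comp_aeval_apply c (Algebra.ofId ℂ P) _).symm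
  set u := eval c (homogeneousComponent e G)
  have hgx : Polynomial.eval₂ φ.toRingHom x g = 0 := by
    rw [← hG, hg]
    let ψ : Polynomial P →ₐ[ℂ] K :=
      { Polynomial.eval₂RingHom φ.toRingHom x with
        commutes' := fun r => by
          rw [Polynomial.algebraMap_apply]
          exact (Polynomial.eval₂_C _ _).trans (φ.commutes r) }
    change ψ (aeval f G) = _
    rw [MvPolynomial.comp_aeval_apply]
    have hφC : ∀ r : ℂ, φ (C r) = algebraMap ℂ K r := fun r => aeval_C _ _
    have hφX : ∀ j, φ (X j) = s j := fun j => aeval_X _ _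
    congr 2
    ext o
    rcases o with _ | j <;>
      simp only [ψ, f, Option.elim, AlgHom.coe_mk, Polynomial.coe_eval₂RingHom,
        Polynomial.eval₂_mul, Polynomial.eval₂_add, Polynomial.eval₂_C, Polynomial.eval₂_X,
        Algebra.smul_def, AlgHom.toRingHom_eq_coe, RingHom.coe_coe, hφC, hφX]
  refine ⟨Polynomial.C (algebraMap ℂ P u⁻¹) * g, ?_, ?_⟩
  · refine Polynomial.monic_of_natDegree_le_of_coeff_eq_one (1 * e)
      ((Polynomial.natDegree_C_mul_le _ _).trans h₁) ?_
    rw [Polynomial.coeff_C_mul, hlead, ← map_mul, inv_mul_cancel₀ hc, map_one]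
  · rw [Polynomial.eval₂_mul, hgx, mul_zero]

theorem mem_span_of_relation {K : Type*} [Field K] [Algebra ℂ K] {D : ℕ} {s : Fin D → K}
    (hs : AlgebraicIndependent ℂ s) {x : K} (c : Option (Fin D) → ℂ)
    (G : MvPolynomial (Option (Fin D)) ℂ)
    (hG : aeval (fun o : Option (Fin D) =>
      o.elim (c none • x) (fun j => s j + c (some j) • x)) G = 0)
    (hc : eval c (homogeneousComponent G.totalDegree G) ≠ 0)
    (hx : x ∈ IntermediateField.adjoin ℂ (Set.range s)) :
    x ∈ Submodule.span ℂ (insert 1 (Set.range s)) := by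
  have hxint := isIntegralElem_of_relation c G hG hc
  set e := G.totalDegree with he
  let P := MvPolynomial (Fin D) ℂ
  let φ : P →ₐ[ℂ] K := aeval s
  have hφ : Function.Injective φ := hs
  rw [IntermediateField.mem_adjoin_range_iff] at hx
  obtain ⟨a, b, hab⟩ := hx
  let Q := FractionRing P
  let Φ : Q →+* K := IsFractionRing.lift (g := φ.toRingHom) hφ
  have hΦ : ∀ p : P, Φ (algebraMap P Q p) = φ p := fun p => IsFractionRing.lift_algebraMap hφ p
  have hξ : Φ (algebraMap P Q a / algebraMap P Q b) = x := by
    rw [map_div₀, hΦ, hΦ, hab]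
  have hxint' : IsIntegral P (algebraMap P Q a / algebraMap P Q b) := by
    obtain ⟨q, hq, hqx⟩ := hxint
    refine ⟨q, hq, Φ.injective ?_⟩
    rw [map_zero, Polynomial.hom_eval₂, hξ, ← hqx]
    exact congrArg (fun r => Polynomial.eval₂ r x q) (RingHom.ext hΦ)
  obtain ⟨p, hp⟩ := IsIntegrallyClosed.isIntegral_iff.1 hxint'
  have hpx : φ p = x := by rw [← hξ, ← hp, hΦ]
  have hGp : aeval (fun o : Option (Fin D) =>
      o.elim (c none • p) (fun j => X j + c (some j) • p)) G = 0 := by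
    apply hφ
    rw [map_zero, ← hG, MvPolynomial.comp_aeval_apply]
    have hφX : ∀ j, φ (X j) = s j := fun j => aeval_X _ _
    congr 2
    ext o
    rcases o with _ | j <;>
      simp only [Option.elim, map_add, map_smul, hpx, hφX]
  have hdeg : p.totalDegree ≤ 1 := by
    by_contra! hd
    set d := p.totalDegree with hd'
    have hne : homogeneousComponent d p ≠ 0 := homogeneousComponent_totalDegree_ne_zero (by
      rintro rfl
      simp [d] at hd)
    obtain ⟨a, ha⟩ : ∃ a, eval a (homogeneousComponent d p) ≠ 0 := by
      by_contra! h
      exact hne (MvPolynomial.funext fun a => by rw [h a, map_zero])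
    let ψ : P →ₐ[ℂ] Polynomial ℂ := aeval fun j => Polynomial.C (a j) * Polynomial.X
    obtain ⟨h₃, h₄⟩ := natDegree_aeval_le_and_coeff
      (fun j => Polynomial.C (a j) * Polynomial.X) one_pos
      (fun j => by compute_degree) p (le_refl p.totalDegree)
    rw [← hd', one_mul] at h₃ h₄
    have hψX : ∀ j, ψ (X j) = Polynomial.C (a j) * Polynomial.X := fun j => aeval_X _ _
    have hψp : (ψ p).coeff d = eval a (homogeneousComponent d p) := by
      rw [h₄, ← MvPolynomial.aeval_eq_eval]
      simp
    have h₅ := congrArg ψ hGp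
    rw [map_zero, MvPolynomial.comp_aeval_apply] at h₅
    obtain ⟨-, h₆⟩ := natDegree_aeval_le_and_coeff
      (fun o : Option (Fin D) => ψ (o.elim (c none • p) (fun j => X j + c (some j) • p)))
      (d := d) (by omega) (by
        rintro (_ | j) <;> simp only [Option.elim, map_add, map_smul, hψX]
        · exact (Polynomial.natDegree_smul_le _ _).trans h₃
        · refine Polynomial.natDegree_add_le_of_degree_le ?_
            ((Polynomial.natDegree_smul_le _ _).trans h₃)
          exact (Polynomial.natDegree_C_mul_le _ _).trans
            (Polynomial.natDegree_X_le.trans (by omega))) G (le_refl G.totalDegree)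
    rw [h₅, Polynomial.coeff_zero, ← he] at h₆
    refine mul_ne_zero (pow_ne_zero e ha) hc ?_
    rw [← (homogeneousComponent_isHomogeneous e G).eval_mul_left, ← MvPolynomial.aeval_eq_eval,
      h₆]
    congr 2
    ext o
    rcases o with _ | j
    · change _ = (ψ (c none • p)).coeff d
      rw [map_smul, Polynomial.coeff_smul, hψp]
      simp [mul_comm]
    · change _ = (ψ (X j + c (some j) • p)).coeff d
      rw [map_add, map_smul, Polynomial.coeff_add, Polynomial.coeff_smul, hψp, hψX,
        Polynomial.coeff_C_mul, Polynomial.coeff_X, if_neg (by omega)]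
      simp [mul_comm]
  rw [← hpx, p.as_sum, map_sum]
  refine Submodule.sum_mem _ fun m hm => ?_
  have hm1 : m.degree ≤ 1 := (le_totalDegree hm).trans hdeg
  rw [show φ (monomial m (coeff m p)) = _ from aeval_monomial _ _ _, ← Algebra.smul_def]
  refine Submodule.smul_mem _ _ (Submodule.subset_span ?_)
  rcases Nat.le_one_iff_eq_zero_or_eq_one.1 hm1 with h | h
  · rw [Finsupp.degree_eq_zero_iff] at h
    simp [h]
  · obtain ⟨j, rfl⟩ := (Finsupp.range_single_one (σ := Fin D)).ge h
    simp

theorem isAlgebraic_of_relation {K : Type*} [Field K] [Algebra ℂ K] {D : ℕ} {s : Fin D → K}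
    {x : K} (c : Option (Fin D) → ℂ) (G : MvPolynomial (Option (Fin D)) ℂ)
    (hG : aeval (fun o : Option (Fin D) =>
      o.elim (c none • x) (fun j => s j + c (some j) • x)) G = 0)
    (hc : eval c (homogeneousComponent G.totalDegree G) ≠ 0) :
    IsAlgebraic (Algebra.adjoin ℂ (Set.range s)) x := by
  obtain ⟨q, hq, hqx⟩ := isIntegralElem_of_relation c G hG hc
  let ρ : MvPolynomial (Fin D) ℂ →+* Algebra.adjoin ℂ (Set.range s) :=
    ((aeval s).codRestrict _ fun p => by
      rw [Algebra.adjoin_range_eq_range_aeval]; exact ⟨p, rfl⟩).toRingHom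
  have : IsIntegral (Algebra.adjoin ℂ (Set.range s)) x := by
    refine ⟨q.map ρ, hq.map ρ, ?_⟩
    rw [Polynomial.eval₂_map]
    exact hqx
  exact this.isAlgebraic

theorem AlgebraicIndependent.linearIndependent_monomials {ι K : Type*} [Field K] [Algebra ℂ K]
    {s : ι → K} (hs : AlgebraicIndependent ℂ s) :
    LinearIndependent ℂ fun m : ι →₀ ℕ => m.prod fun i k => s i ^ k := by
  have := (basisMonomials ι ℂ).linearIndependent.map' (aeval s).toLinearMap
    (LinearMap.ker_eq_bot.2 hs)
  have hfun : (aeval s).toLinearMap ∘ (basisMonomials ι ℂ) =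
      fun m : ι →₀ ℕ => m.prod fun i k => s i ^ k := by
    ext m
    simp [aeval_monomial]
  rwa [hfun] at this

theorem AlgebraicIndependent.finrank_span_insert_one {K : Type*} [Field K] [Algebra ℂ K] {D : ℕ}
    {s : Fin D → K} (hs : AlgebraicIndependent ℂ s) :
    Module.finrank ℂ (Submodule.span ℂ (insert 1 (Set.range s))) = D + 1 := by
  have hli := hs.linearIndependent_monomials.comp
    (fun o : Option (Fin D) => o.elim 0 fun j => Finsupp.single j 1) (by
      rintro (_ | i) (_ | j) h
      · rfl
      · simp [eq_comm] at h
      · simp at h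
      · exact congrArg some (Finsupp.single_left_injective one_ne_zero h))
  have h := finrank_span_eq_card hli
  rw [Fintype.card_option, Fintype.card_fin] at h
  rw [← h]
  have hset : insert 1 (Set.range s) =
      Set.range ((fun m : Fin D →₀ ℕ => m.prod fun i k => s i ^ k) ∘
      fun o : Option (Fin D) => o.elim 0 fun j => Finsupp.single j 1) := by
    ext a
    have : ∀ j, (Finsupp.single j 1 : Fin D →₀ ℕ).prod (fun i k => s i ^ k) = s j := fun j => by
      rw [Finsupp.prod_single_index (h := fun i k => s i ^ k) (pow_zero _), pow_one]
    simp only [Set.mem_insert_iff, Set.mem_range, Function.comp_apply, Option.exists, Option.elim,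
      this, Finsupp.prod_zero_index, eq_comm]
  rw [hset]

theorem exists_isTranscendenceBasis_linear {K ι : Type*} [Finite ι] [Field K] [Algebra ℂ K]
    (y : ι → K) (hy : IntermediateField.adjoin ℂ (Set.range y) = ⊤) :
    ∃ (D : ℕ) (s : Fin D → K), (∀ j, s j ∈ Submodule.span ℂ (Set.range y)) ∧
      IsTranscendenceBasis ℂ s ∧
      ((∀ i, y i ∈ Submodule.span ℂ (insert 1 (Set.range s))) ∨
        ∃ x ∈ Submodule.span ℂ (Set.range y), x ∉ IntermediateField.adjoin ℂ (Set.range s)) := by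
  have halg : Algebra.IsAlgebraic (Algebra.adjoin ℂ (Set.range y)) K := by
    rw [← IntermediateField.isAlgebraic_adjoin_iff_top, hy]
    exact ⟨fun x => isAlgebraic_algebraMap (⟨x, trivial⟩ : (⊤ : IntermediateField ℂ K))⟩
  obtain ⟨t, hty, ht⟩ := exists_isTranscendenceBasis_subset (R := ℂ) (Set.range y)
  have hfin : t.Finite := (Set.finite_range y).subset hty
  have := hfin.fintype
  obtain ⟨D, ⟨eqv⟩⟩ : ∃ D, Nonempty (Fin D ≃ t) := ⟨_, ⟨(Fintype.equivFin t).symm⟩⟩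
  set s : Fin D → K := fun j => eqv j with hs
  have hsb : IsTranscendenceBasis ℂ s := by
    have := ht.comp_equiv eqv
    exact this
  have hsy : ∀ j, s j ∈ Submodule.span ℂ (Set.range y) :=
    fun j => Submodule.subset_span (hty (eqv j).2)
  by_cases hall : ∀ i, y i ∈ Submodule.span ℂ (insert 1 (Set.range s))
  · exact ⟨D, s, hsy, hsb, Or.inl hall⟩
  push Not at hall
  obtain ⟨i, hi⟩ := hall
  set x := y i
  obtain ⟨G, hG0, hGx⟩ : ∃ G : MvPolynomial (Option (Fin D)) ℂ, G ≠ 0 ∧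
      aeval (fun o : Option (Fin D) => o.elim x s) G = 0 := by
    have : ¬ AlgebraicIndependent ℂ (fun o : Option (Fin D) => o.elim x s) := by
      rw [hsb.1.option_iff_transcendental]
      exact fun h => h (hsb.isAlgebraic.isAlgebraic x)
    rw [algebraicIndependent_iff] at this
    push Not at this
    obtain ⟨G, h, h'⟩ := this
    exact ⟨G, h', h⟩
  obtain ⟨c, hc⟩ : ∃ c : Option (Fin D) → ℂ,
      eval c (X none * homogeneousComponent G.totalDegree G) ≠ 0 := by
    by_contra! h
    exact mul_ne_zero (X_ne_zero none) (homogeneousComponent_totalDegree_ne_zero hG0)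
      (MvPolynomial.funext fun a => by rw [h a, map_zero])
  rw [map_mul, eval_X] at hc
  have hc0 := left_ne_zero_of_mul hc
  set x₀ := (c none)⁻¹ • x with hx₀
  have hxx₀ : x = c none • x₀ := by rw [hx₀, smul_smul, mul_inv_cancel₀ hc0, one_smul]
  set s' : Fin D → K := fun j => s j - c (some j) • x₀ with hs'
  have hx₀y : x₀ ∈ Submodule.span ℂ (Set.range y) :=
    Submodule.smul_mem _ _ (Submodule.subset_span ⟨i, rfl⟩)
  have hrel : aeval (fun o : Option (Fin D) =>
      o.elim (c none • x₀) (fun j => s' j + c (some j) • x₀)) G = 0 := by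
    rw [← hGx, ← hxx₀]
    congr 2
    ext o
    rcases o with _ | j <;> simp [hs']
  have hx₀alg := isAlgebraic_of_relation c G hrel (right_ne_zero_of_mul hc)
  have hsalg' : Algebra.IsAlgebraic (Algebra.adjoin ℂ (Set.range s')) K := by
    refine ⟨fun a => IsAlgebraic.adjoin_of_forall_isAlgebraic (s := Set.range s) ?_
      (hsb.isAlgebraic.isAlgebraic a)⟩
    rintro _ ⟨⟨j, rfl⟩, -⟩
    have : s j = s' j + c (some j) • x₀ := by simp [hs']
    rw [this]
    refine IsAlgebraic.add ?_ ?_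
    · exact isAlgebraic_algebraMap
        (⟨s' j, Algebra.subset_adjoin ⟨j, rfl⟩⟩ : Algebra.adjoin ℂ (Set.range s'))
    · rw [← algebraMap_smul (Algebra.adjoin ℂ (Set.range s')) (c (some j)) x₀]
      exact hx₀alg.smul _
  have htb : IsTranscendenceBasis ℂ s' :=
    Algebra.IsAlgebraic.isTranscendenceBasis_of_lift_le_trdeg_of_finite ℂ s'
      hsb.lift_cardinalMk_eq_trdeg.le
  refine ⟨D, s', fun j => Submodule.sub_mem _ (hsy j) (Submodule.smul_mem _ _ hx₀y), htb,
    Or.inr ⟨x₀, hx₀y, fun hmem => hi ?_⟩⟩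
  have hlin := mem_span_of_relation htb.1 c G hrel (right_ne_zero_of_mul hc) hmem
  have hle : Submodule.span ℂ (insert 1 (Set.range s)) ≤
      Submodule.span ℂ (insert 1 (Set.range s')) := by
    rw [Submodule.span_le]
    rintro _ (rfl | ⟨j, rfl⟩)
    · exact Submodule.subset_span (Set.mem_insert _ _)
    · have : s j = s' j + c (some j) • x₀ := by simp [hs']
      rw [this]
      exact Submodule.add_mem _ (Submodule.subset_span (Set.mem_insert_of_mem _ ⟨j, rfl⟩))
        (Submodule.smul_mem _ _ hlin)
  have hfd : FiniteDimensional ℂ (Submodule.span ℂ (insert 1 (Set.range s'))) :=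
    FiniteDimensional.span_of_finite ℂ ((Set.finite_range s').insert 1)
  rw [Submodule.eq_of_le_of_finrank_eq hle (by
    rw [hsb.1.finrank_span_insert_one, htb.1.finrank_span_insert_one]), hxx₀]
  exact Submodule.smul_mem _ _ hlin

/-- Noether normalization by linear forms: either the generic point `y` is linear in the
transcendence basis, or some linear form in `y` is not rational over that basis. -/
theorem exists_algebraicIndependent_linear {K ι : Type*} [Finite ι] [Field K] [Algebra ℂ K]
    (y : ι → K) :
    ∃ (D : ℕ) (s : Fin D → K), (∀ j, s j ∈ Submodule.span ℂ (Set.range y)) ∧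
      AlgebraicIndependent ℂ s ∧
      (∀ i, IsAlgebraic (Algebra.adjoin ℂ (Set.range s)) (y i)) ∧
      ((∀ i, y i ∈ Submodule.span ℂ (insert 1 (Set.range s))) ∨
        ∃ x ∈ Submodule.span ℂ (Set.range y), x ∉ IntermediateField.adjoin ℂ (Set.range s)) := by
  let E := IntermediateField.adjoin ℂ (Set.range y)
  let y' : ι → E := fun i => ⟨y i, IntermediateField.subset_adjoin _ _ ⟨i, rfl⟩⟩
  have hval : Function.Injective E.val := E.val.injective
  have hy' : E.val ∘ y' = y := rfl
  have htop : IntermediateField.adjoin ℂ (Set.range y') = ⊤ := by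
    apply IntermediateField.map_injective E.val
    rw [IntermediateField.adjoin_map, ← Set.range_comp, hy', ← AlgHom.fieldRange_eq_map,
      IntermediateField.fieldRange_val]
  obtain ⟨D, s, hsy, hsb, hcase⟩ := exists_isTranscendenceBasis_linear y' htop
  have hspan : ∀ S : Set E, ∀ x ∈ Submodule.span ℂ S,
      E.val x ∈ Submodule.span ℂ (E.val '' S) := fun S x hx => by
    have := Submodule.apply_mem_span_image_of_mem_span E.val.toLinearMap hx
    exact this
  have hind : AlgebraicIndependent ℂ (E.val ∘ s) :=
    (AlgHom.algebraicIndependent_iff E.val hval).2 hsb.1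
  have hspany : ∀ x ∈ Submodule.span ℂ (Set.range y'),
      E.val x ∈ Submodule.span ℂ (Set.range y) := fun x hx => by
    have := hspan _ x hx
    rwa [← Set.range_comp, hy'] at this
  refine ⟨D, E.val ∘ s, fun j => hspany _ (hsy j), hind, fun i => ?_, ?_⟩
  · by_contra h
    have h₁ := (hind.option_iff_transcendental (y i)).2 h
    have h₂ : (fun o : Option (Fin D) => o.elim (y i) (E.val ∘ s)) =
        E.val ∘ fun o : Option (Fin D) => o.elim (y' i) s := by
      ext o
      rcases o with _ | j <;> rfl
    rw [h₂, AlgHom.algebraicIndependent_iff E.val hval, hsb.1.option_iff_transcendental] at h₁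
    exact h₁ (hsb.isAlgebraic.isAlgebraic _)
  · refine hcase.imp (fun h i => ?_) ?_
    · have := hspan _ _ (h i)
      rw [Set.image_insert_eq, map_one, ← Set.range_comp] at this
      exact this
    · rintro ⟨x, hx, hxs⟩
      refine ⟨E.val x, hspany x hx, fun h => hxs ?_⟩
      rw [Set.range_comp, ← IntermediateField.adjoin_map] at h
      obtain ⟨x', hx', hxx'⟩ := h
      rwa [← hval hxx']

theorem eval_homogeneousComponent_eq_zero_of_cone {σ : Type*} {S : Set (σ → ℂ)}
    (hS : ∀ a ∈ S, ∀ t : ℂ, t • a ∈ S) {p : MvPolynomial σ ℂ} (hp : ∀ a ∈ S, eval a p = 0)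
    (k : ℕ) : ∀ a ∈ S, eval a (homogeneousComponent k p) = 0 := by
  intro a ha
  let q : Polynomial ℂ := ∑ j ∈ Finset.range (p.totalDegree + 1),
    Polynomial.monomial j (eval a (homogeneousComponent j p))
  have hq : q = 0 := by
    refine Polynomial.funext fun t => ?_
    rw [Polynomial.eval_zero, ← hp _ (hS a ha t)]
    conv_rhs => rw [← sum_homogeneousComponent p]
    rw [map_sum, Polynomial.eval_finsetSum]
    refine Finset.sum_congr rfl fun j _ => ?_
    rw [Polynomial.eval_monomial, mul_comm]
    exact ((homogeneousComponent_isHomogeneous j p).eval_mul_left t a).symm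
  by_cases hk : k < p.totalDegree + 1
  · have := congrArg (Polynomial.coeff · k) hq
    simpa [q, Polynomial.finsetSum_coeff, Polynomial.coeff_monomial, Nat.lt_succ_iff.1 hk]
      using this
  · rw [homogeneousComponent_eq_zero _ _ (by omega), map_zero]

theorem mul_aeval_sub_aeval_mem {σ K : Type*} [CommRing K] [Algebra ℂ K] {y z : σ → K}
    {V R : Submodule ℂ K} (hy : ∀ i, y i ∈ V) (hz : ∀ i, z i ∈ V) (hyz : ∀ i, y i - z i ∈ R)
    {p : MvPolynomial σ ℂ} {k : ℕ} (hp : p.IsHomogeneous k) {v : K} (hv : v ∈ V) :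
    v * (aeval y p - aeval z p) ∈ R * V ^ k := by
  have hmon : ∀ m : σ →₀ ℕ, (m.prod fun i k => y i ^ k) ∈ V ^ m.degree ∧
      (m.prod fun i k => z i ^ k) ∈ V ^ m.degree ∧ ∀ v ∈ V,
      v * ((m.prod fun i k => y i ^ k) - m.prod fun i k => z i ^ k) ∈ R * V ^ m.degree := by
    intro m
    induction m using Finsupp.induction_linear with
    | zero => simp [Submodule.one_le.1 le_rfl]
    | add a b ha hb =>
      rw [Finsupp.prod_add_index' (by simp) (by simp [pow_add]),
        Finsupp.prod_add_index' (by simp) (by simp [pow_add]), map_add, pow_add]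
      refine ⟨Submodule.mul_mem_mul ha.1 hb.1, Submodule.mul_mem_mul ha.2.1 hb.2.1, fun v hv => ?_⟩
      have h₁ := Submodule.mul_mem_mul (hb.2.2 v hv) ha.1
      have h₂ := Submodule.mul_mem_mul (ha.2.2 v hv) hb.2.1
      rw [mul_assoc, mul_comm (V ^ b.degree)] at h₁
      rw [mul_assoc] at h₂
      convert Submodule.add_mem _ h₁ h₂ using 1
      ring
    | single i k =>
      rw [Finsupp.prod_single_index (by simp), Finsupp.prod_single_index (by simp),
        Finsupp.degree_single]
      refine ⟨Submodule.pow_mem_pow _ (hy i) k, Submodule.pow_mem_pow _ (hz i) k, ?_⟩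
      induction k with
      | zero => simp
      | succ k ih =>
        intro v hv
        have h₁ := Submodule.mul_mem_mul (hyz i)
          (Submodule.mul_mem_mul (Submodule.pow_mem_pow _ (hy i) k) hv)
        have h₂ := Submodule.mul_mem_mul (ih v hv) (hz i)
        rw [← pow_succ] at h₁
        rw [mul_assoc, ← pow_succ] at h₂
        convert Submodule.add_mem _ h₁ h₂ using 1
        ring
  rw [p.as_sum, map_sum, map_sum, ← Finset.sum_sub_distrib, Finset.mul_sum]
  refine Submodule.sum_mem _ fun m hm => ?_
  have hdeg : m.degree = k := (hp.degree_eq_sum_deg_support hm).symm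
  have := Submodule.smul_mem _ (coeff m p) ((hmon m).2.2 v hv)
  rw [hdeg] at this
  rw [aeval_monomial, aeval_monomial, ← Algebra.smul_def, ← Algebra.smul_def, ← smul_sub,
    mul_smul_comm]
  exact this

theorem prod_mem_pow {ι K : Type*} [CommRing K] [Algebra ℂ K] {V : Submodule ℂ K} (s : Finset ι)
    (f : ι → K) (hf : ∀ i ∈ s, f i ∈ V) : ∏ i ∈ s, f i ∈ V ^ s.card := by
  classical
  induction s using Finset.induction_on with
  | empty => simp [Submodule.one_le.1 le_rfl]
  | insert a s ha ih =>
    rw [Finset.prod_insert ha, Finset.card_insert_of_notMem ha, pow_succ']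
    exact Submodule.mul_mem_mul (hf a (Finset.mem_insert_self _ _))
      (ih fun i hi => hf i (Finset.mem_insert_of_mem hi))

theorem exists_pow_succ_le_mul_pow {K : Type*} [CommRing K] [Algebra ℂ K] (T : Set K)
    (hT : T.Finite) (R : Submodule ℂ K) (k : ℕ)
    (h : ∀ g ∈ T, ∀ v ∈ Submodule.span ℂ T, v * g ^ k ∈ R * Submodule.span ℂ T ^ k) :
    ∃ m, Submodule.span ℂ T ^ (m + 1) ≤ R * Submodule.span ℂ T ^ m := by
  classical
  set V := Submodule.span ℂ T with hV
  refine ⟨hT.toFinset.card * k, ?_⟩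
  set M := hT.toFinset.card * k
  rw [hV, Submodule.span_pow, Submodule.span_le]
  intro a ha
  obtain ⟨f, rfl⟩ := Set.mem_pow.1 ha
  rw [List.prod_ofFn]
  obtain ⟨g, hg, hcard⟩ := Finset.exists_lt_card_fiber_of_mul_lt_card_of_maps_to
    (s := (Finset.univ : Finset (Fin (M + 1)))) (t := hT.toFinset)
    (f := fun i => (f i : K)) (n := k)
    (fun i _ => hT.mem_toFinset.2 (f i).2) (by simp [M])
  set s := {i ∈ (Finset.univ : Finset (Fin (M + 1))) | (f i : K) = g} with hs
  have hgT := hT.mem_toFinset.1 hg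
  have hgV : g ∈ V := Submodule.subset_span hgT
  have h₁ : ∏ i ∈ s, (f i : K) = g ^ s.card :=
    Finset.prod_eq_pow_card fun i hi => (Finset.mem_filter.1 hi).2
  have h₂ : ∏ i ∈ sᶜ, (f i : K) ∈ V ^ sᶜ.card :=
    prod_mem_pow _ _ fun i _ => Submodule.subset_span (f i).2
  have hc : s.card + sᶜ.card = M + 1 := by
    rw [Finset.card_add_card_compl, Fintype.card_fin]
  obtain ⟨r, hr⟩ : ∃ r, s.card = k + 1 + r := ⟨s.card - (k + 1), by omega⟩
  have h₃ := Submodule.mul_mem_mul (h g hgT g hgV)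
    (Submodule.mul_mem_mul (Submodule.pow_mem_pow _ hgV r) h₂)
  rw [← pow_add, mul_assoc, ← pow_add, show k + (r + sᶜ.card) = M by omega] at h₃
  rw [← Finset.prod_mul_prod_compl s, h₁, hr]
  rw [SetLike.mem_coe, ← hV]
  convert h₃ using 1
  ring

theorem pow_add_le_pow_mul_pow {K : Type*} [CommRing K] [Algebra ℂ K] {V R : Submodule ℂ K} {m : ℕ}
    (h : V ^ (m + 1) ≤ R * V ^ m) (n : ℕ) : V ^ (n + m) ≤ R ^ n * V ^ m := by
  induction n with
  | zero => simp
  | succ n ih =>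
    calc V ^ (n + 1 + m) = V * V ^ (n + m) := by rw [← pow_succ']; congr 1; ring
      _ ≤ V * (R ^ n * V ^ m) := mul_le_mul_right ih V
      _ = R ^ n * V ^ (m + 1) := by ring
      _ ≤ R ^ n * (R * V ^ m) := mul_le_mul_right h _
      _ = R ^ (n + 1) * V ^ m := by ring

theorem isIntegral_of_pow_le {K : Type*} [Field K] [Algebra ℂ K] {V R : Submodule ℂ K} {m : ℕ}
    (hV : V.FG) (h1 : 1 ∈ V) (h : V ^ (m + 1) ≤ R * V ^ m) {x : K} (hx : x ∈ V)
    (A : Subalgebra ℂ K) (hRA : (R : Set K) ⊆ A) : IsIntegral A x := by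
  obtain ⟨T, hT⟩ := hV.pow m
  have hspan : ∀ v ∈ V ^ m, v ∈ Submodule.span A (T : Set K) := fun v hv => by
    rw [← hT] at hv
    exact Submodule.span_le_restrictScalars ℂ A (T : Set K) hv
  have hmul : ∀ v ∈ R * V ^ m, v ∈ Submodule.span A (T : Set K) := by
    intro v hv
    exact Submodule.mul_induction_on hv
      (fun r hr u hu => Submodule.smul_mem _ (⟨r, hRA hr⟩ : A) (hspan u hu))
      fun a b => Submodule.add_mem _
  refine isIntegral_of_smul_mem_submodule (Submodule.span A (T : Set K)) ?_ ⟨T, rfl⟩ x ?_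
  · intro hbot
    have := hspan 1 (by simpa using Submodule.pow_mem_pow V h1 m)
    rw [hbot, Submodule.mem_bot] at this
    exact one_ne_zero this
  · intro n hn
    induction hn using Submodule.span_induction with
    | mem u hu =>
      have hu' : u ∈ V ^ m := hT ▸ Submodule.subset_span hu
      refine hmul _ (h ?_)
      rw [pow_succ']
      exact Submodule.mul_mem_mul hx hu'
    | zero => simp
    | add a b _ _ ha hb => rw [smul_add]; exact Submodule.add_mem _ ha hb
    | smul a b _ hb => rw [smul_comm]; exact Submodule.smul_mem _ _ hb

theorem exists_X_pow_eq_add {n : ℕ} {Y₁ Y₂ : Set (Fin n → ℂ)}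
    (h₁ : ZClosed Y₁) (h₂ : ZClosed Y₂) (hdisj : Y₁ ∩ Y₂ ⊆ {0}) :
    ∃ k, 0 < k ∧ ∀ i, ∃ p q : MvPolynomial (Fin n) ℂ, X i ^ k = p + q ∧
      (∀ a ∈ Y₁, eval a p = 0) ∧ (∀ a ∈ Y₂, eval a q = 0) := by
  let I₁ := vanishingIdeal ℂ Y₁
  let I₂ := vanishingIdeal ℂ Y₂
  have hI : ∀ (Y : Set (Fin n → ℂ)) p, p ∈ vanishingIdeal ℂ Y ↔ ∀ a ∈ Y, eval a p = 0 := by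
    intro Y p
    rw [mem_vanishingIdeal_iff]
    simp_rw [MvPolynomial.aeval_eq_eval]
  have hclosed : ∀ Y : Set (Fin n → ℂ), ZClosed Y → ∀ x,
      (∀ p ∈ vanishingIdeal ℂ Y, eval x p = 0) → x ∈ Y := by
    intro Y hY x hx
    rw [← hY]
    exact fun p hp => hx p ((hI Y p).2 hp)
  have hrad : ∀ i, X i ∈ (I₁ ⊔ I₂).radical := by
    intro i
    rw [← vanishingIdeal_zeroLocus_eq_radical (K := ℂ), hI]
    intro a ha
    rw [mem_zeroLocus_iff] at ha
    simp_rw [MvPolynomial.aeval_eq_eval] at ha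
    have h0 := hdisj ⟨hclosed _ h₁ a fun p hp => ha p (Ideal.mem_sup_left hp),
      hclosed _ h₂ a fun p hp => ha p (Ideal.mem_sup_right hp)⟩
    rw [Set.mem_singleton_iff] at h0
    simp [h0]
  choose k hk using hrad
  refine ⟨1 + ∑ i, k i, by omega, fun i => ?_⟩
  have hle : k i ≤ 1 + ∑ i, k i :=
    (Finset.single_le_sum (fun _ _ => Nat.zero_le _) (Finset.mem_univ i)).trans (by omega)
  have hmem := Ideal.pow_mem_of_pow_mem _ (hk i) hle
  obtain ⟨p, hp, q, hq, hpq⟩ := Submodule.mem_sup.1 hmem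
  exact ⟨p, q, hpq.symm, (hI _ _).1 hp, (hI _ _).1 hq⟩

/-- The projection `(y, z) ↦ y + z` is finite when the two cones meet only at the origin. -/
theorem exists_pow_succ_le_of_disjoint {n : ℕ} {Y₁ Y₂ : Set (Fin n → ℂ)}
    (h₁ : ZClosed Y₁) (h₂ : ZClosed Y₂) (hdisj : Y₁ ∩ Y₂ ⊆ {0})
    (hc₁ : ∀ a ∈ Y₁, ∀ t : ℂ, t • a ∈ Y₁) (hc₂ : ∀ a ∈ Y₂, ∀ t : ℂ, t • a ∈ Y₂)
    {K : Type*} [CommRing K] [Algebra ℂ K] {y z : Fin n → K}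
    (hy : ∀ p : MvPolynomial (Fin n) ℂ, (∀ a ∈ Y₁, eval a p = 0) → aeval y p = 0)
    (hz : ∀ p : MvPolynomial (Fin n) ℂ, (∀ a ∈ Y₂, eval a p = 0) → aeval z p = 0) :
    ∃ m, Submodule.span ℂ (insert 1 (Set.range y ∪ Set.range z)) ^ (m + 1) ≤
      Submodule.span ℂ (insert 1 (Set.range fun i => y i + z i)) *
        Submodule.span ℂ (insert 1 (Set.range y ∪ Set.range z)) ^ m := by
  obtain ⟨k, hk0, hk⟩ := exists_X_pow_eq_add h₁ h₂ hdisj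
  have hfin : (insert 1 (Set.range y ∪ Set.range z)).Finite :=
    ((Set.finite_range y).union (Set.finite_range z)).insert 1
  set T := insert 1 (Set.range y ∪ Set.range z)
  set V := Submodule.span ℂ T
  set R := Submodule.span ℂ (insert 1 (Set.range fun i => y i + z i))
  have h1V : (1 : K) ∈ V := Submodule.subset_span (Set.mem_insert _ _)
  have h1R : (1 : K) ∈ R := Submodule.subset_span (Set.mem_insert _ _)
  have hyV : ∀ i, y i ∈ V := fun i => Submodule.subset_span (Or.inr (Or.inl ⟨i, rfl⟩))
  have hzV : ∀ i, z i ∈ V := fun i => Submodule.subset_span (Or.inr (Or.inr ⟨i, rfl⟩))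
  have hzV' : ∀ i, (-z) i ∈ V := fun i => Submodule.neg_mem _ (hzV i)
  have hyz : ∀ i, y i - (-z) i ∈ R := fun i => by
    have : y i + z i ∈ R := Submodule.subset_span (Set.mem_insert_of_mem _ ⟨i, rfl⟩)
    simpa using this
  have hz' : ∀ p : MvPolynomial (Fin n) ℂ, (∀ a ∈ Y₂, eval a p = 0) → aeval (-z) p = 0 := by
    intro p hp
    have := hz (aeval (fun i => -X i : Fin n → MvPolynomial (Fin n) ℂ) p) fun a ha => by
      rw [← MvPolynomial.aeval_eq_eval, MvPolynomial.comp_aeval_apply, MvPolynomial.aeval_eq_eval,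
        ← hp _ (hc₂ a ha (-1))]
      congr 2
      ext i
      simp
    rw [MvPolynomial.comp_aeval_apply] at this
    have hneg : (fun i => aeval z (-X i : MvPolynomial (Fin n) ℂ)) = -z := by ext i; simp
    rwa [hneg] at this
  have key : ∀ i, ∀ v ∈ V, v * y i ^ k ∈ R * V ^ k := by
    intro i v hv
    obtain ⟨p, q, hpq, hp, hq⟩ := hk i
    have hpq' : X i ^ k = homogeneousComponent k p + homogeneousComponent k q := by
      rw [← map_add, ← hpq, homogeneousComponent_eq_self (isHomogeneous_X_pow i k)]
    have hp' := hy _ (eval_homogeneousComponent_eq_zero_of_cone hc₁ hp k)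
    have hq' := hz' _ (eval_homogeneousComponent_eq_zero_of_cone hc₂ hq k)
    have hyk : y i ^ k = aeval y (homogeneousComponent k q) := by
      have := congrArg (aeval y) hpq'
      rwa [map_add, hp', zero_add, map_pow, aeval_X] at this
    have := mul_aeval_sub_aeval_mem hyV hzV' hyz (homogeneousComponent_isHomogeneous k q) hv
    rwa [hq', sub_zero, ← hyk] at this
  refine exists_pow_succ_le_mul_pow T hfin R k ?_
  rintro g (rfl | ⟨i, rfl⟩ | ⟨i, rfl⟩) v hv
  · obtain ⟨k, rfl⟩ : ∃ j, k = j + 1 := ⟨k - 1, by omega⟩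
    rw [one_pow, mul_one, ← one_mul v]
    refine Submodule.mul_mem_mul h1R ?_
    rw [pow_succ']
    simpa using Submodule.mul_mem_mul hv (Submodule.pow_mem_pow V h1V k)
  · exact key i v hv
  · have h := mul_aeval_sub_aeval_mem hyV hzV' hyz (isHomogeneous_X_pow (R := ℂ) i k) hv
    rw [map_pow, map_pow, aeval_X, aeval_X] at h
    have h' := Submodule.smul_mem _ ((-1 : ℂ) ^ k) (Submodule.sub_mem _ (key i v hv) h)
    convert h' using 1
    rw [Pi.neg_apply, neg_pow (z i), Algebra.smul_def, map_pow, map_neg, map_one]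
    have : ((-1 : K) ^ k) * (-1) ^ k = 1 := by rw [← mul_pow]; simp
    linear_combination (-(v * z i ^ k)) * this

theorem mem_intermediateField_of_fixed {F K : Type*} [Field F] [CharZero F] [Field K] [Algebra F K]
    (L : IntermediateField F K) [Algebra.IsAlgebraic L K] (x : K)
    (h : ∀ σ : AlgebraicClosure K ≃ₐ[L] AlgebraicClosure K,
      σ (algebraMap K (AlgebraicClosure K) x) = algebraMap K (AlgebraicClosure K) x) : x ∈ L := by
  have : Algebra.IsAlgebraic L (AlgebraicClosure K) := Algebra.IsAlgebraic.trans L K _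
  have : CharZero L := algebraRat.charZero L
  have : IsAlgClosure L (AlgebraicClosure K) := ⟨inferInstance, inferInstance⟩
  have : Normal L (AlgebraicClosure K) := IsAlgClosure.normal L _
  have : IsGalois L (AlgebraicClosure K) := ⟨⟩
  obtain ⟨l, hl⟩ := IntermediateField.mem_bot.1 ((InfiniteGalois.mem_bot_iff_fixed _).2 h)
  rw [IsScalarTower.algebraMap_apply L K (AlgebraicClosure K)] at hl
  rw [← (algebraMap K (AlgebraicClosure K)).injective hl]
  exact l.2

/-- A generically unique decomposition `w = y + z` makes `y` rational in `w`. -/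
theorem mem_adjoin_of_unique_decomposition {n : ℕ} {Y₁ Y₂ : Set (Fin n → ℂ)}
    (h₁ : ZClosed Y₁) (h₂ : ZClosed Y₂) (hn₁ : ∃ a ∈ Y₁, a ≠ 0) (hn₂ : ∃ a ∈ Y₂, a ≠ 0)
    (q : MvPolynomial (Fin n) ℂ)
    (hq : ∃ a ∈ Y₁, ∃ b ∈ Y₂, eval (a + b) q ≠ 0)
    (huniq : ∀ a ∈ Y₁, ∀ b ∈ Y₂, ∀ a' ∈ Y₁, ∀ b' ∈ Y₂, a ≠ 0 → b ≠ 0 → a' ≠ 0 → b' ≠ 0 →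
      a + b = a' + b' → eval (a + b) q ≠ 0 → a = a')
    {K : Type*} [Field K] [Algebra ℂ K] {y z : Fin n → K}
    (hgen : ∀ p : MvPolynomial (Fin n ⊕ Fin n) ℂ, aeval (Sum.elim y z) p = 0 ↔
        ∀ a ∈ Y₁, ∀ b ∈ Y₂, eval (Sum.elim a b) p = 0)
    (halg : Algebra.IsAlgebraic (IntermediateField.adjoin ℂ (Set.range fun i => y i + z i)) K)
    (i : Fin n) : y i ∈ IntermediateField.adjoin ℂ (Set.range fun i => y i + z i) := by
  set L := IntermediateField.adjoin ℂ (Set.range fun i => y i + z i)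
  refine mem_intermediateField_of_fixed L _ fun σ => ?_
  let Ω := AlgebraicClosure K
  let ι : K →ₐ[ℂ] Ω := IsScalarTower.toAlgHom ℂ K Ω
  let σ' : Ω →ₐ[ℂ] Ω := (σ : Ω →ₐ[L] Ω).restrictScalars ℂ
  have hσL : ∀ x ∈ L, σ' (ι x) = ι x := fun x hx => σ.commutes ⟨x, hx⟩
  have hgen' : ∀ p : MvPolynomial (Fin n ⊕ Fin n) ℂ,
      (∀ a ∈ Y₁, ∀ b ∈ Y₂, eval (Sum.elim a b) p = 0) →
      aeval (fun j => ι (Sum.elim y z j)) p = 0 ∧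
      aeval (fun j => σ' (ι (Sum.elim y z j))) p = 0 := by
    intro p hp
    rw [← MvPolynomial.comp_aeval_apply, ← MvPolynomial.comp_aeval_apply,
      ← MvPolynomial.comp_aeval_apply, (hgen p).2 hp]
    simp
  let ω : (Fin n ⊕ Fin n) ⊕ (Fin n ⊕ Fin n) → Ω :=
    Sum.elim (fun j => ι (Sum.elim y z j)) (fun j => σ' (ι (Sum.elim y z j)))
  let P : Set (MvPolynomial (Fin n ⊕ Fin n) ℂ) :=
    {p | ∀ a ∈ Y₁, ∀ b ∈ Y₂, eval (Sum.elim a b) p = 0}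
  let S : Set (MvPolynomial ((Fin n ⊕ Fin n) ⊕ (Fin n ⊕ Fin n)) ℂ) :=
    (rename Sum.inl '' P ∪ rename Sum.inr '' P) ∪ Set.range fun j : Fin n =>
      X (Sum.inl (Sum.inl j)) + X (Sum.inl (Sum.inr j)) -
        (X (Sum.inr (Sum.inl j)) + X (Sum.inr (Sum.inr j)))
  have hω : ∀ p ∈ S, aeval ω p = 0 := by
    rintro _ ((⟨p, hp, rfl⟩ | ⟨p, hp, rfl⟩) | ⟨j, rfl⟩)
    · rw [aeval_rename]; exact (hgen' p hp).1
    · rw [aeval_rename]; exact (hgen' p hp).2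
    · have := hσL (y j + z j) (IntermediateField.subset_adjoin _ _ ⟨j, rfl⟩)
      rw [map_add, map_add] at this
      simp [ω, this]
  have hmem : ∀ a : Fin n ⊕ Fin n → ℂ, (∀ p ∈ P, eval a p = 0) →
      a ∘ Sum.inl ∈ Y₁ ∧ a ∘ Sum.inr ∈ Y₂ := by
    intro a ha
    constructor
    · rw [← h₁]
      intro p hp
      have := ha (rename Sum.inl p) fun b hb c _ => by
        rw [eval_rename]; exact hp b hb
      rwa [eval_rename] at this
    · rw [← h₂]
      intro p hp
      have := ha (rename Sum.inr p) fun b _ c hc => by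
        rw [eval_rename]; exact hp c hc
      rwa [eval_rename] at this
  let f (j l : Fin n) : MvPolynomial ((Fin n ⊕ Fin n) ⊕ (Fin n ⊕ Fin n)) ℂ :=
    aeval (fun j => X (Sum.inl (Sum.inl j)) + X (Sum.inl (Sum.inr j))) q *
      (X (Sum.inl (Sum.inl j)) * X (Sum.inl (Sum.inr l)) *
        X (Sum.inr (Sum.inl j)) * X (Sum.inr (Sum.inr l))) *
      (X (Sum.inl (Sum.inl i)) - X (Sum.inr (Sum.inl i)))
  have hf : ∀ j l, aeval ω (f j l) = 0 := by
    intro j l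
    refine nullstellensatz_transfer S (f j l) (fun a ha => ?_) ω hω
    obtain ⟨hy, hz⟩ := hmem (a ∘ Sum.inl) fun p hp => by
      rw [← eval_rename]; exact ha _ (Or.inl (Or.inl ⟨p, hp, rfl⟩))
    obtain ⟨hy', hz'⟩ := hmem (a ∘ Sum.inr) fun p hp => by
      rw [← eval_rename]; exact ha _ (Or.inl (Or.inr ⟨p, hp, rfl⟩))
    have hsum : (a ∘ Sum.inl) ∘ Sum.inl + (a ∘ Sum.inl) ∘ Sum.inr =
        (a ∘ Sum.inr) ∘ Sum.inl + (a ∘ Sum.inr) ∘ Sum.inr := by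
      ext j
      have := ha _ (Or.inr ⟨j, rfl⟩)
      simpa [sub_eq_zero] using this
    by_contra hne
    simp only [f, map_mul, map_sub, eval_X] at hne
    have hqe : eval a (aeval (fun j => X (Sum.inl (Sum.inl j)) + X (Sum.inl (Sum.inr j))) q) =
        eval ((a ∘ Sum.inl) ∘ Sum.inl + (a ∘ Sum.inl) ∘ Sum.inr) q := by
      rw [← MvPolynomial.aeval_eq_eval, MvPolynomial.comp_aeval_apply, MvPolynomial.aeval_eq_eval]
      congr 2
      ext j
      simp
    rw [hqe] at hne
    simp only [mul_ne_zero_iff, sub_ne_zero] at hne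
    obtain ⟨⟨hq0, ⟨⟨h1, h2⟩, h3⟩, h4⟩, h5⟩ := hne
    refine h5 (congrFun (huniq _ hy _ hz _ hy' _ hz' ?_ ?_ ?_ ?_ hsum hq0) i)
    · exact fun h => h1 (congrFun h j)
    · exact fun h => h2 (congrFun h l)
    · exact fun h => h3 (congrFun h j)
    · exact fun h => h4 (congrFun h l)
  obtain ⟨a, ha, ha0⟩ := hn₁
  obtain ⟨b, hb, hb0⟩ := hn₂
  obtain ⟨j, hj⟩ := Function.ne_iff.1 ha0
  obtain ⟨l, hl⟩ := Function.ne_iff.1 hb0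
  have hyj : y j ≠ 0 := fun h => hj (by
    simpa using (hgen (X (Sum.inl j))).1 (by simpa using h) a ha b hb)
  have hzl : z l ≠ 0 := fun h => hl (by
    simpa using (hgen (X (Sum.inr l))).1 (by simpa using h) a ha b hb)
  have hqw : aeval (fun i => y i + z i) q ≠ 0 := by
    intro h
    obtain ⟨a, ha, b, hb, hab⟩ := hq
    have := (hgen (aeval (fun j => (X (Sum.inl j) + X (Sum.inr j) :
        MvPolynomial (Fin n ⊕ Fin n) ℂ)) q)).1 (by
      rw [MvPolynomial.comp_aeval_apply]
      simpa using h) a ha b hb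
    rw [← MvPolynomial.aeval_eq_eval, MvPolynomial.comp_aeval_apply,
      MvPolynomial.aeval_eq_eval] at this
    refine hab ?_
    rw [← this]
    congr 2
    ext j
    simp
  have hfin := hf j l
  have hιq : aeval ω (aeval (fun j => (X (Sum.inl (Sum.inl j)) + X (Sum.inl (Sum.inr j)) :
      MvPolynomial ((Fin n ⊕ Fin n) ⊕ (Fin n ⊕ Fin n)) ℂ)) q) =
      ι (aeval (fun i => y i + z i) q) := by
    rw [MvPolynomial.comp_aeval_apply, MvPolynomial.comp_aeval_apply]
    congr 2
    ext j
    simp [ω]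
  simp only [f, map_mul, map_sub, aeval_X, hιq] at hfin
  have hι : ∀ x, x ≠ 0 → ι x ≠ 0 := fun x hx h => hx ((map_eq_zero_iff ι (RingHom.injective _)).1 h)
  have hσ : ∀ x, x ≠ 0 → σ' x ≠ 0 := fun x hx h =>
    hx ((map_eq_zero_iff σ' (RingHom.injective _)).1 h)
  have := (mul_eq_zero.1 hfin).resolve_left (mul_ne_zero (hι _ hqw) (mul_ne_zero (mul_ne_zero
    (mul_ne_zero (hι _ hyj) (hι _ hzl)) (hσ _ (hι _ hyj))) (hσ _ (hι _ hzl))))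
  exact (sub_eq_zero.1 this).symm

theorem ncard_degree_le (σ : Type*) [Finite σ] (n : ℕ) :
    {α : σ →₀ ℕ | α.degree ≤ n}.ncard = (n + Nat.card σ).choose (Nat.card σ) := by
  classical
  have := Fintype.ofFinite σ
  have h : {α : σ →₀ ℕ | α.degree ≤ n} =
      ((Finset.range (n + 1)).biUnion fun i => (Finset.univ : Finset σ).finsuppAntidiag i :
        Finset (σ →₀ ℕ)) := by
    ext α
    simp [Finset.mem_finsuppAntidiag, Finsupp.degree_eq_sum]
  rw [h, Set.ncard_coe_finset, Finset.card_biUnion]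
  · simp only [Finset.card_finsuppAntidiag_nat_eq_multichoose, Finset.card_univ,
      ← Nat.card_eq_fintype_card]
    rw [Nat.sum_range_multichoose]
  · intro i _ j _ hij
    refine Finset.disjoint_left.2 fun α h₁ h₂ => ?_
    rw [Finset.mem_finsuppAntidiag] at h₁ h₂
    exact hij (h₁.1.symm.trans h₂.1)

theorem finrank_restrictTotalDegree (σ : Type*) [Finite σ] (n : ℕ) :
    Module.finrank ℂ (restrictTotalDegree σ ℂ n) = (n + Nat.card σ).choose (Nat.card σ) := by
  rw [← ncard_degree_le, restrictTotalDegree,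
    Module.finrank_eq_nat_card_basis (basisRestrictSupport ℂ _)]
  rfl

theorem span_pow_le_map_restrictTotalDegree {K σ : Type*} [CommRing K] [Algebra ℂ K] (w : σ → K)
    (k : ℕ) : Submodule.span ℂ (insert 1 (Set.range w)) ^ k ≤
      (restrictTotalDegree σ ℂ k).map (aeval w).toLinearMap := by
  induction k with
  | zero =>
    rw [pow_zero, Submodule.one_le]
    exact ⟨1, by simp [mem_restrictTotalDegree], by simp⟩
  | succ k ih =>
    rw [pow_succ]
    refine Submodule.mul_le.2 fun a ha b hb => ?_
    obtain ⟨p, hp, rfl⟩ := ih ha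
    have hb' : b ∈ (restrictTotalDegree σ ℂ 1).map (aeval w).toLinearMap := by
      refine Submodule.span_le.2 ?_ hb
      rintro _ (rfl | ⟨i, rfl⟩)
      · exact ⟨1, by simp [mem_restrictTotalDegree], by simp⟩
      · exact ⟨X i, by simp [mem_restrictTotalDegree], by simp⟩
    obtain ⟨q, hq, rfl⟩ := hb'
    refine ⟨p * q, ?_, by simp⟩
    rw [SetLike.mem_coe, mem_restrictTotalDegree] at *
    exact (totalDegree_mul _ _).trans (by omega)

theorem finrank_span_pow_le {K : Type*} [CommRing K] [Algebra ℂ K] {N : ℕ}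
    {F : MvPolynomial (Fin (N + 1)) ℂ} (hF : F ≠ 0) (hF3 : F.totalDegree ≤ 3)
    (w : Fin (N + 1) → K) (hw : aeval w F = 0) (k : ℕ) :
    Module.finrank ℂ ↥(Submodule.span ℂ (insert 1 (Set.range w)) ^ (k + 3)) ≤
      3 * (k + 3 + N).choose N := by
  let P := restrictTotalDegree (Fin (N + 1)) ℂ
  let φ : P (k + 3) →ₗ[ℂ] K := (aeval w).toLinearMap.domRestrict (P (k + 3))
  have h₁ : Module.finrank ℂ ↥(Submodule.span ℂ (insert 1 (Set.range w)) ^ (k + 3)) ≤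
      Module.finrank ℂ (LinearMap.range φ) := by
    refine Submodule.finrank_mono ?_
    rw [LinearMap.range_domRestrict]
    exact span_pow_le_map_restrictTotalDegree w _
  let ψ : P k →ₗ[ℂ] LinearMap.ker φ :=
    ((LinearMap.mulLeft ℂ F).restrict (p := P k) (q := P (k + 3)) fun p hp => by
      rw [mem_restrictTotalDegree] at *
      exact (totalDegree_mul _ _).trans (by omega)).codRestrict _ fun p => by
        simp [φ, hw]
  have hψ : Function.Injective ψ := fun p q h => Subtype.ext <| mul_left_cancel₀ hF
    (congrArg (fun x : LinearMap.ker φ => (x : MvPolynomial (Fin (N + 1)) ℂ)) h)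
  have h₂ := LinearMap.finrank_le_finrank_of_injective hψ
  have h₃ := φ.finrank_range_add_finrank_ker
  simp only [P, finrank_restrictTotalDegree, Nat.card_eq_fintype_card, Fintype.card_fin] at h₂ h₃
  have e₁ : (k + 3 + (N + 1)).choose (N + 1) =
      (k + 2 + N).choose N + (k + 1 + N).choose N + (k + 3 + N).choose N +
        (k + (N + 1)).choose (N + 1) := by
    rw [show k + 3 + (N + 1) = (k + 3 + N) + 1 by ring, Nat.choose_succ_succ,
      show k + 3 + N = (k + 2 + N) + 1 by ring, Nat.choose_succ_succ (k + 2 + N) N,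
      show k + 2 + N = (k + 1 + N) + 1 by ring, Nat.choose_succ_succ (k + 1 + N) N,
      show k + (N + 1) = k + 1 + N by ring]
    ring
  have e₂ : (k + 2 + N).choose N ≤ (k + 3 + N).choose N := Nat.choose_le_choose _ (by omega)
  have e₃ : (k + 1 + N).choose N ≤ (k + 3 + N).choose N := Nat.choose_le_choose _ (by omega)
  omega

theorem AlgebraicIndependent.linearIndependent_monomials_mul_pow {K ι : Type*} [Field K]
    [Algebra ℂ K] {s : ι → K} (hs : AlgebraicIndependent ℂ s) {x : K}
    (hx : x ∉ IntermediateField.adjoin ℂ (Set.range s)) :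
    LinearIndependent ℂ fun m : (ι →₀ ℕ) × Fin 2 =>
      (m.1.prod fun i k => s i ^ k) * x ^ (m.2 : ℕ) := by
  set E := IntermediateField.adjoin ℂ (Set.range s)
  let s' : ι → E := fun i => ⟨s i, IntermediateField.subset_adjoin _ _ ⟨i, rfl⟩⟩
  have hs' : AlgebraicIndependent ℂ s' :=
    (AlgHom.algebraicIndependent_iff E.val E.val.injective).1 hs
  have hx' : LinearIndependent E fun a : Fin 2 => x ^ (a : ℕ) := by
    have : (fun a : Fin 2 => x ^ (a : ℕ)) = ![1, x] := by
      ext a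
      fin_cases a <;> simp
    rw [this, LinearIndependent.pair_iff]
    intro a b hab
    have hb : b = 0 := by
      by_contra hb
      refine hx ?_
      have : x = -(b : K)⁻¹ * a := by
        have hb' : (b : K) ≠ 0 := fun h => hb (Subtype.ext h)
        have hab' : (a : K) * 1 + b * x = 0 := hab
        field_simp
        linear_combination hab'
      rw [this]
      exact E.mul_mem (E.neg_mem (E.inv_mem b.2)) a.2
    subst hb
    simpa [Algebra.smul_def] using hab
  have := linearIndependent_smul hs'.linearIndependent_monomials hx'
  convert this using 2 with m
  rw [Algebra.smul_def]
  congr 1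
  simp [Finsupp.prod, s']

theorem aeval_left_eq_zero {σ τ : Type*} {Y₁ : Set (σ → ℂ)} {Y₂ : Set (τ → ℂ)}
    {K : Type*} [CommRing K] [Algebra ℂ K] {y : σ → K} {z : τ → K}
    (hgen : ∀ p : MvPolynomial (σ ⊕ τ) ℂ, aeval (Sum.elim y z) p = 0 ↔
        ∀ a ∈ Y₁, ∀ b ∈ Y₂, eval (Sum.elim a b) p = 0)
    (p : MvPolynomial σ ℂ) (hp : ∀ a ∈ Y₁, eval a p = 0) : aeval y p = 0 := by
  have := (hgen (rename Sum.inl p)).2 fun a ha b hb => by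
    rw [eval_rename]; exact hp a ha
  rwa [aeval_rename] at this

theorem aeval_right_eq_zero {σ τ : Type*} {Y₁ : Set (σ → ℂ)} {Y₂ : Set (τ → ℂ)}
    {K : Type*} [CommRing K] [Algebra ℂ K] {y : σ → K} {z : τ → K}
    (hgen : ∀ p : MvPolynomial (σ ⊕ τ) ℂ, aeval (Sum.elim y z) p = 0 ↔
        ∀ a ∈ Y₁, ∀ b ∈ Y₂, eval (Sum.elim a b) p = 0)
    (p : MvPolynomial τ ℂ) (hp : ∀ b ∈ Y₂, eval b p = 0) : aeval z p = 0 := by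
  have := (hgen (rename Sum.inr p)).2 fun a ha b hb => by
    rw [eval_rename]; exact hp b hb
  rwa [aeval_rename] at this

theorem linearIndependent_mul_of_generic {σ τ ι κ : Type*} {Y₁ : Set (σ → ℂ)} {Y₂ : Set (τ → ℂ)}
    {K : Type*} [Field K] [Algebra ℂ K] {y : σ → K} {z : τ → K}
    (hgen : ∀ p : MvPolynomial (σ ⊕ τ) ℂ, aeval (Sum.elim y z) p = 0 ↔
        ∀ a ∈ Y₁, ∀ b ∈ Y₂, eval (Sum.elim a b) p = 0)
    {u : ι → K} {v : κ → K} (hu : LinearIndependent ℂ u) (hv : LinearIndependent ℂ v)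
    (hu' : ∀ i, u i ∈ Algebra.adjoin ℂ (Set.range y))
    (hv' : ∀ i, v i ∈ Algebra.adjoin ℂ (Set.range z)) :
    LinearIndependent ℂ fun m : ι × κ => u m.1 * v m.2 := by
  classical
  simp only [Algebra.adjoin_range_eq_range_aeval, AlgHom.mem_range] at hu' hv'
  choose p hp using hu'
  choose q hq using hv'
  rw [linearIndependent_iff'] at hu hv ⊢
  intro s g hg
  let c : ι → κ → ℂ := fun i j => if (i, j) ∈ s then g (i, j) else 0
  have hsum : aeval (Sum.elim y z) (∑ i ∈ s.image Prod.fst, ∑ j ∈ s.image Prod.snd,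
      C (c i j) * (rename Sum.inl (p i) * rename Sum.inr (q j))) = 0 := by
    rw [← hg, ← Finset.sum_product', map_sum]
    have hsub : s ⊆ s.image Prod.fst ×ˢ s.image Prod.snd := Finset.subset_product
    rw [← Finset.sum_subset hsub fun m _ hm => by simp [c, hm]]
    refine Finset.sum_congr rfl fun m hm => ?_
    simp only [map_mul, aeval_rename, algHom_C, c, if_pos hm, ← Algebra.smul_def]
    rw [← hp, ← hq]
    rfl
  rw [hgen] at hsum
  have hrow : ∀ a ∈ Y₁, ∀ j ∈ s.image Prod.snd,
      ∑ i ∈ s.image Prod.fst, c i j * eval a (p i) = 0 := by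
    intro a ha
    refine hv _ _ ?_
    have := aeval_right_eq_zero hgen (∑ j ∈ s.image Prod.snd,
      C (∑ i ∈ s.image Prod.fst, c i j * eval a (p i)) * q j) fun b hb => by
        rw [← hsum a ha b hb]
        simp only [map_sum, map_mul, eval_C, eval_rename, Finset.sum_mul, Sum.elim_comp_inl,
          Sum.elim_comp_inr, mul_assoc]
        exact Finset.sum_comm
    rw [← this]
    simp only [map_sum (aeval z), map_mul, algHom_C, Algebra.smul_def, hq]
  rintro ⟨i, j⟩ hij
  have hi : i ∈ s.image Prod.fst := Finset.mem_image_of_mem _ hij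
  have hj : j ∈ s.image Prod.snd := Finset.mem_image_of_mem _ hij
  have := hu (s.image Prod.fst) (fun i => c i j) (by
    have := aeval_left_eq_zero hgen (∑ i ∈ s.image Prod.fst, C (c i j) * p i) fun a ha => by
      simpa using hrow a ha j hj
    rw [← this]
    simp only [map_sum (aeval y), map_mul, algHom_C, Algebra.smul_def, hp]) i hi
  simpa [c, hij] using this

theorem finsuppProd_mem_pow {K ι : Type*} [CommRing K] [Algebra ℂ K] {V : Submodule ℂ K}
    {s : ι → K} (hs : ∀ i, s i ∈ V) (α : ι →₀ ℕ) :
    (α.prod fun i k => s i ^ k) ∈ V ^ α.degree := by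
  classical
  rw [Finsupp.prod, Finsupp.degree_apply]
  induction α.support using Finset.induction_on with
  | empty => simp [Submodule.one_le.1 le_rfl]
  | insert a S ha ih =>
    rw [Finset.prod_insert ha, Finset.sum_insert ha, pow_add]
    exact Submodule.mul_mem_mul (Submodule.pow_mem_pow V (hs a) _) ih

/-- If both factors have degree at least two, then the product has degree at least four. -/
theorem choose_le_finrank_span_pow {K ι κ : Type*} [Finite ι] [Finite κ] [Field K] [Algebra ℂ K]
    {V : Submodule ℂ K} (hV : V.FG) (h1 : 1 ∈ V) {s : ι → K} {t : κ → K} {x x' : K}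
    (hs : ∀ i, s i ∈ V) (ht : ∀ i, t i ∈ V) (hx : x ∈ V) (hx' : x' ∈ V)
    (h : LinearIndependent ℂ fun m : ((ι →₀ ℕ) × Fin 2) × ((κ →₀ ℕ) × Fin 2) =>
      ((m.1.1.prod fun i k => s i ^ k) * x ^ (m.1.2 : ℕ)) *
        ((m.2.1.prod fun i k => t i ^ k) * x' ^ (m.2.2 : ℕ))) (n : ℕ) :
    4 * (n + (Nat.card ι + Nat.card κ)).choose (Nat.card ι + Nat.card κ) ≤
      Module.finrank ℂ ↥(V ^ (n + 2)) := by
  have := Fintype.ofFinite ι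
  have := Fintype.ofFinite κ
  have hfin : Module.Finite ℂ ↥(V ^ (n + 2)) := Module.Finite.iff_fg.2 (hV.pow _)
  let T : Set ((ι ⊕ κ) →₀ ℕ) := {γ | γ.degree ≤ n}
  have hT : T.Finite := Finsupp.finite_of_degree_le n
  have := hT.fintype
  let e : T × (Fin 2 × Fin 2) → ((ι →₀ ℕ) × Fin 2) × ((κ →₀ ℕ) × Fin 2) := fun m =>
    (((Finsupp.sumFinsuppEquivProdFinsupp m.1.1).1, m.2.1),
      ((Finsupp.sumFinsuppEquivProdFinsupp m.1.1).2, m.2.2))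
  have he : Function.Injective e := by
    rintro ⟨γ, a, b⟩ ⟨γ', a', b'⟩ hee
    simp only [e, Prod.mk.injEq] at hee
    have : γ = γ' := Subtype.ext
      (Finsupp.sumFinsuppEquivProdFinsupp.injective (Prod.ext hee.1.1 hee.2.1))
    rw [this, hee.1.2, hee.2.2]
  have hmem : ∀ m, (((e m).1.1.prod fun i k => s i ^ k) * x ^ ((e m).1.2 : ℕ)) *
        (((e m).2.1.prod fun i k => t i ^ k) * x' ^ ((e m).2.2 : ℕ)) ∈ V ^ (n + 2) := by
    intro m
    have hdeg : (e m).1.1.degree + (e m).2.1.degree ≤ n := by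
      have := m.1.2
      simp only [T, Set.mem_ofPred_eq, Finsupp.degree_eq_sum, Fintype.sum_sum_type] at this
      simpa only [Finsupp.degree_eq_sum, e, Finsupp.fst_sumFinsuppEquivProdFinsupp,
        Finsupp.snd_sumFinsuppEquivProdFinsupp] using this
    have := Submodule.mul_mem_mul
      (Submodule.mul_mem_mul (finsuppProd_mem_pow hs (e m).1.1)
        (Submodule.pow_mem_pow V hx ((e m).1.2 : ℕ)))
      (Submodule.mul_mem_mul (finsuppProd_mem_pow ht (e m).2.1)
        (Submodule.pow_mem_pow V hx' ((e m).2.2 : ℕ)))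
    rw [← pow_add, ← pow_add, ← pow_add] at this
    exact pow_le_pow_right' (Submodule.one_le.2 h1) (by omega) this
  have hli := h.comp e he
  have hli' : LinearIndependent ℂ fun m => (⟨_, hmem m⟩ : ↥(V ^ (n + 2))) :=
    LinearIndependent.of_comp (V ^ (n + 2)).subtype hli
  have := hli'.fintype_card_le_finrank
  rw [Fintype.card_prod, Fintype.card_prod, Fintype.card_fin, ← Nat.card_eq_fintype_card,
    Nat.card_coe_set_eq, ncard_degree_le, Nat.card_sum] at this
  omega

theorem aeval_mem_span_pow {K σ : Type*} [CommRing K] [Algebra ℂ K] (w : σ → K)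
    (p : MvPolynomial σ ℂ) {k : ℕ} (hk : p.totalDegree ≤ k) :
    aeval w p ∈ Submodule.span ℂ (insert 1 (Set.range w)) ^ k := by
  rw [p.as_sum, map_sum]
  refine Submodule.sum_mem _ fun m hm => ?_
  rw [aeval_monomial, ← Algebra.smul_def]
  refine Submodule.smul_mem _ _ ?_
  have hR : 1 ≤ Submodule.span ℂ (insert 1 (Set.range w)) :=
    Submodule.one_le.2 (Submodule.subset_span (Set.mem_insert _ _))
  have hle := pow_le_pow_right' hR ((le_totalDegree hm).trans hk)
  have hw : ∀ i, w i ∈ Submodule.span ℂ (insert 1 (Set.range w)) := fun i =>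
    Submodule.subset_span (Set.mem_insert_of_mem _ ⟨i, rfl⟩)
  exact hle (finsuppProd_mem_pow hw m)

theorem exists_common_denominator {K σ : Type*} [Field K] [Algebra ℂ K] (w : σ → K)
    {V : Submodule ℂ K} (hV : V.FG)
    (hVL : ∀ v ∈ V, v ∈ IntermediateField.adjoin ℂ (Set.range w)) :
    ∃ D : K, D ≠ 0 ∧ ∃ δ : ℕ, ∀ v ∈ V,
      D * v ∈ Submodule.span ℂ (insert 1 (Set.range w)) ^ δ := by
  classical
  obtain ⟨T, rfl⟩ := hV
  set R := Submodule.span ℂ (insert 1 (Set.range w))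
  have hR : 1 ≤ R := Submodule.one_le.2 (Submodule.subset_span (Set.mem_insert _ _))
  suffices h : ∃ D : K, D ≠ 0 ∧ ∃ δ : ℕ, D ∈ R ^ δ ∧ ∀ v ∈ T, D * v ∈ R ^ δ by
    obtain ⟨D, hD, δ, -, h⟩ := h
    refine ⟨D, hD, δ, fun v hv => ?_⟩
    have : Submodule.span ℂ (T : Set K) ≤ (R ^ δ).comap (LinearMap.mulLeft ℂ D) :=
      Submodule.span_le.2 h
    exact this hv
  replace hVL : ∀ v ∈ T, v ∈ IntermediateField.adjoin ℂ (Set.range w) := fun v hv =>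
    hVL v (Submodule.subset_span hv)
  induction T using Finset.induction_on with
  | empty => exact ⟨1, one_ne_zero, 0, by simp [Submodule.one_le.1 le_rfl], by simp⟩
  | insert a S _ ih =>
    obtain ⟨D, hD, δ, hDR, hS⟩ := ih fun v hv => hVL v (Finset.mem_insert_of_mem hv)
    obtain ⟨r, s, ha⟩ := (IntermediateField.mem_adjoin_range_iff ℂ w a).1
      (hVL a (Finset.mem_insert_self _ _))
    by_cases hs : aeval w s = 0
    · rw [hs, div_zero] at ha
      refine ⟨D, hD, δ, hDR, fun v hv => ?_⟩
      rcases Finset.mem_insert.1 hv with rfl | hv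
      · simp [ha]
      · exact hS v hv
    have hmem : ∀ u v : K, u ∈ R ^ δ → v ∈ R ^ (max r.totalDegree s.totalDegree) →
        u * v ∈ R ^ (δ + max r.totalDegree s.totalDegree) := fun u v hu hv => by
      rw [pow_add]
      exact Submodule.mul_mem_mul hu hv
    have hrR := aeval_mem_span_pow w r (le_max_left r.totalDegree s.totalDegree)
    have hsR := aeval_mem_span_pow w s (le_max_right r.totalDegree s.totalDegree)
    refine ⟨D * aeval w s, mul_ne_zero hD hs, _, hmem _ _ hDR hsR, fun v hv => ?_⟩
    rcases Finset.mem_insert.1 hv with rfl | hv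
    · rw [ha, mul_assoc, mul_div_cancel₀ _ hs]
      exact hmem _ _ hDR hrR
    · rw [mul_right_comm]
      exact hmem _ _ (hS v hv) hsR

/-- Up to a shift of the degree, a finite birational projection does not change Hilbert functions. -/
theorem exists_finrank_pow_le {K σ : Type*} [Finite σ] [Field K] [Algebra ℂ K] (w : σ → K)
    {V : Submodule ℂ K} (hV : V.FG)
    (hVL : ∀ v ∈ V, v ∈ IntermediateField.adjoin ℂ (Set.range w)) {m : ℕ}
    (h : V ^ (m + 1) ≤ Submodule.span ℂ (insert 1 (Set.range w)) * V ^ m) :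
    ∃ δ, ∀ n, Module.finrank ℂ ↥(V ^ (n + m)) ≤
      Module.finrank ℂ ↥(Submodule.span ℂ (insert 1 (Set.range w)) ^ (n + δ)) := by
  have hVmL : ∀ v ∈ V ^ m, v ∈ IntermediateField.adjoin ℂ (Set.range w) := by
    clear h
    induction m with
    | zero =>
      intro v hv
      rw [pow_zero] at hv
      obtain ⟨c, rfl⟩ := Submodule.mem_one.1 hv
      exact (IntermediateField.adjoin ℂ (Set.range w)).algebraMap_mem c
    | succ m ih =>
      intro v hv
      rw [pow_succ] at hv
      exact Submodule.mul_induction_on hv (fun a ha b hb => mul_mem (ih a ha) (hVL b hb))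
        fun a b ha hb => add_mem ha hb
  obtain ⟨D, hD, δ, hDV⟩ := exists_common_denominator w (hV.pow m) hVmL
  refine ⟨δ, fun n => ?_⟩
  set R := Submodule.span ℂ (insert 1 (Set.range w))
  have hRfg : R.FG := Submodule.fg_span ((Set.finite_range w).insert 1)
  have : Module.Finite ℂ ↥(R ^ (n + δ)) := Module.Finite.iff_fg.2 (hRfg.pow _)
  have hle : ∀ v ∈ V ^ (n + m), D * v ∈ R ^ (n + δ) := by
    intro v hv
    refine Submodule.mul_induction_on (pow_add_le_pow_mul_pow h n hv) (fun a ha b hb => ?_)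
      fun a b ha hb => by rw [mul_add]; exact Submodule.add_mem _ ha hb
    rw [mul_left_comm, pow_add]
    exact Submodule.mul_mem_mul ha (hDV b hb)
  exact LinearMap.finrank_le_finrank_of_injective
    (f := (LinearMap.mulLeft ℂ D).restrict hle)
    fun a b hab => Subtype.ext (mul_left_cancel₀ hD (congrArg Subtype.val hab))

theorem exists_three_mul_choose_lt (N c : ℕ) :
    ∃ k, 3 * (k + c + N).choose N < 4 * (k + N).choose N := by
  have hstep : ∀ k c : ℕ, ((k + c + N).choose N : ℝ) ≤
      (k + N).choose N * (1 + N * (1 / ((k : ℝ) + 1))) ^ c := by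
    intro k c
    induction c with
    | zero => simp
    | succ c ih =>
      have h := Nat.choose_mul_succ_eq (k + c + N) N
      rw [show k + c + N + 1 - N = k + c + 1 by omega] at h
      have h' : ((k + c + N).choose N : ℝ) * (k + c + N + 1) =
          (k + (c + 1) + N).choose N * (k + c + 1) := by
        rw [show k + (c + 1) + N = k + c + N + 1 by ring]
        exact_mod_cast h
      have h'' : ((k + (c + 1) + N).choose N : ℝ) ≤
          (k + c + N).choose N * (1 + N * (1 / ((k : ℝ) + 1))) := by
        have hk : (0 : ℝ) < k + c + 1 := by positivity
        rw [← mul_le_mul_iff_left₀ hk, ← h', mul_assoc]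
        refine mul_le_mul_of_nonneg_left ?_ (by positivity)
        field_simp
        have : (0 : ℝ) ≤ N * c := by positivity
        nlinarith
      refine h''.trans ?_
      rw [pow_succ, ← mul_assoc]
      exact mul_le_mul_of_nonneg_right ih (by positivity)
  have hlim : Filter.Tendsto (fun k : ℕ => (1 + (N : ℝ) * (1 / ((k : ℝ) + 1))) ^ c)
      Filter.atTop (nhds 1) := by
    have := ((tendsto_one_div_add_atTop_nhds_zero_nat (𝕜 := ℝ)).const_mul (N : ℝ)).const_add 1
    simpa using this.pow c
  obtain ⟨k, hk⟩ := (hlim.eventually_lt_const (by norm_num : (1 : ℝ) < 4 / 3)).exists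
  refine ⟨k, ?_⟩
  have hpos : (0 : ℝ) < (k + N).choose N := by exact_mod_cast Nat.choose_pos (by omega)
  have := hstep k c
  have h2 := mul_lt_mul_of_pos_left hk hpos
  have : (3 * (k + c + N).choose N : ℝ) < 4 * (k + N).choose N := by linarith
  exact_mod_cast this

theorem isAlgebraic_adjoin_of_generators {K : Type*} [Field K] [Algebra ℂ K] {S T : Set K}
    (hT : IntermediateField.adjoin ℂ T = ⊤)
    (h : ∀ x ∈ T, IsAlgebraic (Algebra.adjoin ℂ S) x) :
    Algebra.IsAlgebraic (Algebra.adjoin ℂ S) K := by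
  refine ⟨fun x => ?_⟩
  have hx : x ∈ IntermediateField.adjoin ℂ T := hT ▸ IntermediateField.mem_top
  induction hx using IntermediateField.adjoin_induction with
  | mem x hx => exact h x hx
  | algebraMap c =>
    rw [IsScalarTower.algebraMap_apply ℂ (Algebra.adjoin ℂ S) K]
    exact isAlgebraic_algebraMap _
  | add x y _ _ hx hy => exact hx.add hy
  | inv x _ hx => exact hx.inv
  | mul x y _ _ hx hy => exact hx.mul hy

theorem isAlgebraic_intermediateField_adjoin {K : Type*} [Field K] [Algebra ℂ K] {S T : Set K}
    (hT : IntermediateField.adjoin ℂ T = ⊤)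
    (h : ∀ x ∈ T, IsAlgebraic (Algebra.adjoin ℂ S) x) :
    Algebra.IsAlgebraic (IntermediateField.adjoin ℂ S) K := by
  have := isAlgebraic_adjoin_of_generators hT h
  exact ⟨fun x => (this.isAlgebraic x).tower_top_of_subalgebra_le
    (B := (IntermediateField.adjoin ℂ S).toSubalgebra)
    (Algebra.adjoin_le (IntermediateField.subset_adjoin ℂ S))⟩

theorem exists_algebraicIndependent_succAbove {N : ℕ} {K : Type*} [CommRing K] [Algebra ℂ K]
    {F : MvPolynomial (Fin (N + 1)) ℂ} (hF : Irreducible F) {w : Fin (N + 1) → K}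
    (hw : ∀ g, aeval w g = 0 → F ∣ g) :
    ∃ j : Fin (N + 1), AlgebraicIndependent ℂ (w ∘ j.succAbove) := by
  obtain ⟨j, hj⟩ : ∃ j, degreeOf j F ≠ 0 := by
    by_contra! h
    have hv : F.vars = ∅ := Finset.eq_empty_of_forall_notMem fun j hj => by
      rw [vars_def, Multiset.mem_toFinset, ← Multiset.count_pos] at hj
      exact hj.ne' (by rw [← degreeOf_def]; exact h j)
    rw [vars_eq_empty_iff_eq_C] at hv
    refine hF.not_isUnit ?_
    rw [hv]
    exact (IsUnit.mk0 (coeff 0 F) fun h0 => hF.ne_zero (by rw [hv, h0, C_0])).map C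
  refine ⟨j, algebraicIndependent_iff.2 fun p hp => ?_⟩
  by_contra hp0
  obtain ⟨g, hg⟩ := hw (rename j.succAbove p) (by rwa [aeval_rename])
  have hr0 : rename j.succAbove p ≠ 0 := fun h =>
    hp0 (rename_injective _ Fin.succAbove_right_injective (by rw [h, map_zero]))
  have hg0 : g ≠ 0 := by
    rintro rfl
    exact hr0 (by rw [hg, mul_zero])
  have hd : degreeOf j (rename j.succAbove p) = 0 := by
    classical
    rw [degreeOf_def, Multiset.count_eq_zero]
    intro h
    obtain ⟨k, -, hk⟩ := mem_vars_rename j.succAbove p (by rwa [vars_def, Multiset.mem_toFinset])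
    exact Fin.succAbove_ne j k hk
  rw [hg, degreeOf_mul_eq hF.ne_zero hg0] at hd
  omega

theorem le_add_of_isAlgebraic {N D₁ D₂ : ℕ} {K : Type*} [Field K] [Algebra ℂ K]
    {ι κ : Type*} {y : ι → K} {z : κ → K} {w : Fin N → K} (hw : AlgebraicIndependent ℂ w)
    (htop : IntermediateField.adjoin ℂ (Set.range y ∪ Set.range z) = ⊤)
    {s : Fin D₁ → K} {t : Fin D₂ → K}
    (hy : ∀ i, IsAlgebraic (Algebra.adjoin ℂ (Set.range s)) (y i))
    (hz : ∀ i, IsAlgebraic (Algebra.adjoin ℂ (Set.range t)) (z i)) : N ≤ D₁ + D₂ := by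
  have := isAlgebraic_adjoin_of_generators (S := Set.range s ∪ Set.range t) htop (by
    rintro _ (⟨i, rfl⟩ | ⟨i, rfl⟩)
    · exact (hy i).tower_top_of_subalgebra_le (Algebra.adjoin_mono Set.subset_union_left)
    · exact (hz i).tower_top_of_subalgebra_le (Algebra.adjoin_mono Set.subset_union_right))
  have h₁ := hw.lift_cardinalMk_le_trdeg
  have h₂ := Algebra.IsAlgebraic.trdeg_le_cardinalMk ℂ (Set.range s ∪ Set.range t)
  have h₃ := Cardinal.mk_union_le (Set.range s) (Set.range t)
  have hs : Cardinal.mk (Set.range s) ≤ D₁ := by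
    simpa using Cardinal.mk_range_le_lift (f := s)
  have ht : Cardinal.mk (Set.range t) ≤ D₂ := by
    simpa using Cardinal.mk_range_le_lift (f := t)
  have h := h₁.trans (Cardinal.lift_le.2 (h₂.trans (h₃.trans (add_le_add hs ht))))
  simp only [Cardinal.mk_fin, Cardinal.lift_natCast, Cardinal.lift_add] at h
  exact_mod_cast h

theorem mem_adjoin_of_mem_span {K ι : Type*} [CommRing K] [Algebra ℂ K] {y : ι → K} {x : K}
    (hx : x ∈ Submodule.span ℂ (Set.range y)) : x ∈ Algebra.adjoin ℂ (Set.range y) :=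
  Algebra.span_le_adjoin ℂ _ hx

/-- A hypersurface of degree at most three is not a finite birational projection of a product
of two cones of degree at least two. -/
theorem not_exists_generic_pair {N : ℕ} {F : MvPolynomial (Fin (N + 1)) ℂ} (hF : Irreducible F)
    (hF3 : F.totalDegree ≤ 3) {Y₁ Y₂ : Set (Fin (N + 1) → ℂ)}
    {K : Type*} [Field K] [Algebra ℂ K] {y z : Fin (N + 1) → K}
    (hgen : ∀ p : MvPolynomial (Fin (N + 1) ⊕ Fin (N + 1)) ℂ, aeval (Sum.elim y z) p = 0 ↔
        ∀ a ∈ Y₁, ∀ b ∈ Y₂, eval (Sum.elim a b) p = 0)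
    (htop : IntermediateField.adjoin ℂ (Set.range y ∪ Set.range z) = ⊤)
    (hw : ∀ g, aeval (fun i => y i + z i) g = 0 ↔ F ∣ g)
    {m : ℕ} (hm : Submodule.span ℂ (insert 1 (Set.range y ∪ Set.range z)) ^ (m + 1) ≤
      Submodule.span ℂ (insert 1 (Set.range fun i => y i + z i)) *
        Submodule.span ℂ (insert 1 (Set.range y ∪ Set.range z)) ^ m)
    (hyL : ∀ i, y i ∈ IntermediateField.adjoin ℂ (Set.range fun i => y i + z i))
    {D₁ D₂ : ℕ} {s : Fin D₁ → K} {t : Fin D₂ → K} {x x' : K}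
    (hsy : ∀ j, s j ∈ Submodule.span ℂ (Set.range y))
    (htz : ∀ j, t j ∈ Submodule.span ℂ (Set.range z))
    (hs : AlgebraicIndependent ℂ s) (ht : AlgebraicIndependent ℂ t)
    (hys : ∀ i, IsAlgebraic (Algebra.adjoin ℂ (Set.range s)) (y i))
    (hzt : ∀ i, IsAlgebraic (Algebra.adjoin ℂ (Set.range t)) (z i))
    (hxy : x ∈ Submodule.span ℂ (Set.range y))
    (hxz : x' ∈ Submodule.span ℂ (Set.range z))
    (hx : x ∉ IntermediateField.adjoin ℂ (Set.range s))
    (hx' : x' ∉ IntermediateField.adjoin ℂ (Set.range t)) : False := by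
  set w : Fin (N + 1) → K := fun i => y i + z i
  set V := Submodule.span ℂ (insert 1 (Set.range y ∪ Set.range z))
  have hVy : Submodule.span ℂ (Set.range y) ≤ V :=
    Submodule.span_mono (Set.subset_union_left.trans (Set.subset_insert _ _))
  have hVz : Submodule.span ℂ (Set.range z) ≤ V :=
    Submodule.span_mono (Set.subset_union_right.trans (Set.subset_insert _ _))
  have hVfg : V.FG :=
    Submodule.fg_span (((Set.finite_range y).union (Set.finite_range z)).insert 1)
  have hVL : V ≤ (IntermediateField.adjoin ℂ (Set.range w)).toSubalgebra.toSubmodule := by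
    refine Submodule.span_le.2 ?_
    rintro _ (rfl | ⟨i, rfl⟩ | ⟨i, rfl⟩)
    · exact one_mem (IntermediateField.adjoin ℂ (Set.range w))
    · exact hyL i
    · have hwi : w i ∈ IntermediateField.adjoin ℂ (Set.range w) :=
        IntermediateField.subset_adjoin _ _ ⟨i, rfl⟩
      have := sub_mem hwi (hyL i)
      rwa [show w i - y i = z i from add_sub_cancel_left _ _] at this
  have hN : N ≤ D₁ + D₂ := by
    obtain ⟨j, hj⟩ := exists_algebraicIndependent_succAbove hF fun g => (hw g).1
    exact le_add_of_isAlgebraic hj htop hys hzt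
  obtain ⟨δ, hδ⟩ := exists_finrank_pow_le w hVfg hVL hm
  have hli := linearIndependent_mul_of_generic hgen
    (hs.linearIndependent_monomials_mul_pow hx) (ht.linearIndependent_monomials_mul_pow hx')
    (fun i => mul_mem (prod_mem fun j _ => pow_mem (mem_adjoin_of_mem_span (hsy j)) _)
      (pow_mem (mem_adjoin_of_mem_span hxy) _))
    (fun i => mul_mem (prod_mem fun j _ => pow_mem (mem_adjoin_of_mem_span (htz j)) _)
      (pow_mem (mem_adjoin_of_mem_span hxz) _))
  obtain ⟨k, hk⟩ := exists_three_mul_choose_lt N (δ + 3)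
  have h₁ := choose_le_finrank_span_pow hVfg (Submodule.subset_span (Set.mem_insert _ _))
    (fun j => hVy (hsy j)) (fun j => hVz (htz j)) (hVy hxy) (hVz hxz) hli (k + 1 + m)
  have h₂ := hδ (k + 3)
  have h₃ := finrank_span_pow_le hF.ne_zero hF3 w ((hw F).2 dvd_rfl) (k + δ)
  rw [show k + 3 + m = k + 1 + m + 2 by ring, show k + 3 + δ = k + δ + 3 by ring] at h₂
  have h₄ : (k + N).choose N ≤ (k + 1 + m + (D₁ + D₂)).choose (D₁ + D₂) := by
    rw [← Nat.choose_symm_add]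
    refine (Nat.choose_le_choose k (by omega : k + N ≤ k + (D₁ + D₂))).trans ?_
    rw [Nat.choose_symm_add]
    exact Nat.choose_le_choose _ (by omega)
  simp only [Nat.card_eq_fintype_card, Fintype.card_fin] at h₁
  rw [← add_assoc] at hk
  omega

theorem add_mem_of_generic_mem_span {n D : ℕ} {Y : Set (Fin n → ℂ)} (hY : ZClosed Y)
    {K : Type*} [CommRing K] [Algebra ℂ K] {y : Fin n → K}
    (hgen : ∀ p : MvPolynomial (Fin n) ℂ, aeval y p = 0 ↔ ∀ a ∈ Y, eval a p = 0)
    {s : Fin D → K} (hs : AlgebraicIndependent ℂ s)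
    (hsy : ∀ j, s j ∈ Submodule.span ℂ (Set.range y))
    (hys : ∀ i, y i ∈ Submodule.span ℂ (insert 1 (Set.range s))) (h0 : 0 ∈ Y) :
    ∀ a ∈ Y, ∀ b ∈ Y, a + b ∈ Y := by
  have hη : ∀ j, ∃ η : MvPolynomial (Fin n) ℂ, aeval y η = s j := fun j => by
    have := mem_adjoin_of_mem_span (hsy j)
    rwa [Algebra.adjoin_range_eq_range_aeval] at this
  have hl : ∀ i, ∃ l : MvPolynomial (Fin D) ℂ, aeval s l = y i ∧
      ∀ u v r : Fin D → ℂ, eval (u + v - r) l = eval u l + eval v l - eval r l := fun i => by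
    obtain ⟨c, v, hv, hcv⟩ := Submodule.mem_span_insert.1 (hys i)
    obtain ⟨e, rfl⟩ := (Submodule.mem_span_range_iff_exists_fun ℂ).1 hv
    refine ⟨C c + ∑ j, C (e j) * X j, ?_, fun u v r => ?_⟩
    · rw [hcv]
      simp [Algebra.smul_def]
    · simp [mul_add, mul_sub, Finset.sum_add_distrib, Finset.sum_sub_distrib]
      ring
  choose η hη using hη
  choose l hl hl' using hl
  have hpt : ∀ u : Fin D → ℂ, (fun i => eval u (l i)) ∈ Y := by
    intro u
    rw [← hY]
    intro p hp
    have h : aeval l p = 0 := by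
      refine hs.eq_zero_of_aeval_eq_zero _ ?_
      rw [MvPolynomial.comp_aeval_apply]
      simp only [hl]
      exact (hgen p).2 hp
    have := congrArg (aeval u) h
    rw [MvPolynomial.comp_aeval_apply, map_zero] at this
    simpa only [MvPolynomial.aeval_eq_eval] using this
  have hpar : ∀ a ∈ Y, ∀ i, a i = eval (fun j => eval a (η j)) (l i) := by
    intro a ha i
    have := (hgen (X i - aeval η (l i))).1 (by
      rw [map_sub, MvPolynomial.comp_aeval_apply, aeval_X]
      simp only [hη, hl, sub_self]) a ha
    rw [map_sub, eval_X, sub_eq_zero, ← MvPolynomial.aeval_eq_eval,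
      MvPolynomial.comp_aeval_apply] at this
    simpa only [MvPolynomial.aeval_eq_eval] using this
  intro a ha b hb
  convert hpt ((fun j => eval a (η j)) + (fun j => eval b (η j)) - fun j => eval 0 (η j)) using 2
    with i
  rw [hl', ← hpar a ha, ← hpar b hb, ← hpar 0 h0]
  simp

theorem exists_vertex_of_add_mem {n : ℕ} {F : MvPolynomial (Fin n) ℂ}
    {Y₁ Y₂ : Set (Fin n → ℂ)} (hadd : ∀ a ∈ Y₁, ∀ b ∈ Y₁, a + b ∈ Y₁)
    (hcone : ∀ a ∈ Y₁, ∀ t : ℂ, t • a ∈ Y₁) (hn : ∃ a ∈ Y₁, a ≠ 0)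
    (hjoin : {y : Fin n → ℂ | eval y F = 0}
      = zcl {w | ∃ y₁ ∈ Y₁, ∃ y₂ ∈ Y₂, ∃ a b : ℂ, w = a • y₁ + b • y₂}) :
    ∃ v : Fin n → ℂ, v ≠ 0 ∧
      ∀ y : Fin n → ℂ, eval y F = 0 → ∀ t : ℂ, eval (y + t • v) F = 0 := by
  obtain ⟨v, hv, hv0⟩ := hn
  refine ⟨v, hv0, fun y hy t => ?_⟩
  have hy' : y ∈ {y : Fin n → ℂ | eval y F = 0} := hy
  rw [hjoin] at hy'
  have heval : ∀ x : Fin n → ℂ,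
      eval x (aeval (fun i => (X i + C (t * v i) : MvPolynomial (Fin n) ℂ)) F) =
        eval (x + t • v) F := by
    intro x
    rw [← MvPolynomial.aeval_eq_eval, MvPolynomial.comp_aeval_apply, MvPolynomial.aeval_eq_eval]
    congr 2
    ext i
    simp
  rw [← heval]
  refine hy' _ ?_
  rintro _ ⟨y₁, hy₁, y₂, hy₂, a, b, rfl⟩
  rw [heval]
  have : a • y₁ + b • y₂ + t • v ∈ {y : Fin n → ℂ | eval y F = 0} := by
    rw [hjoin]
    intro p hp
    refine hp _ ⟨_, hadd _ (hcone _ hy₁ a) _ (hcone _ hv t), y₂, hy₂, 1, b, ?_⟩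
    rw [one_smul]
    abel
  exact this

theorem zclosed_singular {σ : Type*} (F : MvPolynomial σ ℂ) :
    ZClosed {y : σ → ℂ | ∀ i, eval y (pderiv i F) = 0} := by
  have := zclosed_zeros (Set.range fun i => pderiv i F)
  simpa using this

theorem smul_mem_singular {σ : Type*} {F : MvPolynomial σ ℂ} {k : ℕ} (hF : F.IsHomogeneous k) :
    ∀ y ∈ {y : σ → ℂ | ∀ i, eval y (pderiv i F) = 0}, ∀ t : ℂ,
      t • y ∈ {y : σ → ℂ | ∀ i, eval y (pderiv i F) = 0} := by
  intro y hy t i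
  have := hF.pderiv (i := i) |>.eval_mul_left t y
  rw [hy i, mul_zero] at this
  exact this

theorem exists_ne_zero_of_adim {σ : Type*} {S : Set (σ → ℂ)} {d : ℕ}
    (h : adim S = ((d + 1 : ℕ) : ℕ∞)) : ∃ a ∈ S, a ≠ 0 := by
  by_contra! hS
  have : Subsingleton {T : Set (σ → ℂ) // ZIrr T ∧ ZClosed T ∧ T ⊆ S} := by
    have h0 : ∀ T : {T : Set (σ → ℂ) // ZIrr T ∧ ZClosed T ∧ T ⊆ S}, T.1 = {0} := fun T =>
      Set.eq_singleton_iff_nonempty_unique_mem.2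
        ⟨T.2.1.1, fun a ha => hS a (T.2.2.2 ha)⟩
    exact ⟨fun T T' => Subtype.ext ((h0 T).trans (h0 T').symm)⟩
  have hle : adim S ≤ 0 := Order.krullDim_nonpos_of_subsingleton
  rw [h] at hle
  have : d + 1 ≤ 0 := by exact_mod_cast hle
  omega

theorem eval_add_eq_zero_iff_dvd {n : ℕ} {F : MvPolynomial (Fin n) ℂ} (hF : Irreducible F)
    {Y₁ Y₂ : Set (Fin n → ℂ)}
    (hc₁ : ∀ a ∈ Y₁, ∀ t : ℂ, t • a ∈ Y₁) (hc₂ : ∀ a ∈ Y₂, ∀ t : ℂ, t • a ∈ Y₂)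
    (hjoin : {y : Fin n → ℂ | eval y F = 0}
      = zcl {w | ∃ y₁ ∈ Y₁, ∃ y₂ ∈ Y₂, ∃ a b : ℂ, w = a • y₁ + b • y₂})
    (g : MvPolynomial (Fin n) ℂ) :
    (∀ a ∈ Y₁, ∀ b ∈ Y₂, eval (a + b) g = 0) ↔ F ∣ g := by
  constructor
  · intro h
    have hP : (Ideal.span {F}).IsPrime :=
      (Ideal.span_singleton_prime hF.ne_zero).2 hF.prime
    rw [← Ideal.mem_span_singleton, ← IsPrime.vanishingIdeal_zeroLocus (K := ℂ) (Ideal.span {F}),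
      mem_vanishingIdeal_iff, zeroLocus_span]
    intro x hx
    have hx' : x ∈ {y : Fin n → ℂ | eval y F = 0} := by
      have := hx F rfl
      rwa [MvPolynomial.aeval_eq_eval] at this
    rw [hjoin] at hx'
    rw [MvPolynomial.aeval_eq_eval]
    refine hx' g ?_
    rintro _ ⟨y₁, hy₁, y₂, hy₂, a, b, rfl⟩
    exact h _ (hc₁ _ hy₁ a) _ (hc₂ _ hy₂ b)
  · rintro ⟨g, rfl⟩ a ha b hb
    have : a + b ∈ {y : Fin n → ℂ | eval y F = 0} := by
      rw [hjoin]
      exact fun p hp => hp _ ⟨a, ha, b, hb, 1, 1, by simp⟩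
    rw [map_mul, show eval (a + b) F = 0 from this, zero_mul]

theorem eq_of_add_eq_add {n : ℕ} {Y₁ Y₂ : Set (Fin n → ℂ)} (hdisj : Y₁ ∩ Y₂ ⊆ {0})
    (hc₁ : ∀ a ∈ Y₁, ∀ t : ℂ, t • a ∈ Y₁) (hc₂ : ∀ a ∈ Y₂, ∀ t : ℂ, t • a ∈ Y₂)
    {a b : Fin n → ℂ} (ha : a ∈ Y₁) (hb : b ∈ Y₂) {c c' : ℂ}
    (h : a + b = c • a + c' • b) : a = c • a := by
  have hab : (1 - c) • a = (c' - 1) • b := by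
    rw [sub_smul, sub_smul, one_smul, one_smul, sub_eq_sub_iff_add_eq_add, h, add_comm]
  have h0 : (1 - c) • a = 0 := hdisj ⟨hc₁ a ha _, hab ▸ hc₂ b hb _⟩
  rwa [sub_smul, one_smul, sub_eq_zero] at h0

theorem stmt18 {N : ℕ} (F : MvPolynomial (Fin (N + 1)) ℂ)
    (hFirr : Irreducible F) (hFhom : F.IsHomogeneous 3)
    -- Y is not a cone
    (hnotcone : ¬ ∃ v : Fin (N + 1) → ℂ, v ≠ 0 ∧
      ∀ y : Fin (N + 1) → ℂ, eval y F = 0 → ∀ t : ℂ, eval (y + t • v) F = 0)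
    -- Y₁, Y₂ : disjoint irreducible components of the singular locus Y'
    (Y₁ Y₂ : Set (Fin (N + 1) → ℂ))
    (hY₁closed : ZClosed Y₁) (hY₂closed : ZClosed Y₂)
    (hY₁irr : ZIrr Y₁) (hY₂irr : ZIrr Y₂)
    (hY₁sub : Y₁ ⊆ {y | ∀ i, eval y (pderiv i F) = 0})
    (hY₂sub : Y₂ ⊆ {y | ∀ i, eval y (pderiv i F) = 0})
    (hY₁max : ∀ T, ZIrr T → ZClosed T → Y₁ ⊆ T →
      T ⊆ {y | ∀ i, eval y (pderiv i F) = 0} → T = Y₁)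
    (hY₂max : ∀ T, ZIrr T → ZClosed T → Y₂ ⊆ T →
      T ⊆ {y | ∀ i, eval y (pderiv i F) = 0} → T = Y₂)
    (hdisj : Y₁ ∩ Y₂ ⊆ {0})
    -- smoothness of the components of Y'
    (d₁ d₂ : ℕ)
    (hd₁ : adim Y₁ = ((d₁ + 1 : ℕ) : ℕ∞)) (hd₂ : adim Y₂ = ((d₂ + 1 : ℕ) : ℕ∞))
    (hY₁smooth : ∀ v ∈ Y₁, v ≠ 0 →
      Module.rank ℂ (Submodule.span ℂ (ztang Y₁ v)) = ((d₁ + 1 : ℕ) : Cardinal))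
    (hY₂smooth : ∀ v ∈ Y₂, v ≠ 0 →
      Module.rank ℂ (Submodule.span ℂ (ztang Y₂ v)) = ((d₂ + 1 : ℕ) : Cardinal))
    -- Y = S(Y₁, Y₂) is the join of Y₁ and Y₂
    (hjoin : {y : Fin (N + 1) → ℂ | eval y F = 0}
      = zcl {w | ∃ y₁ ∈ Y₁, ∃ y₂ ∈ Y₂, ∃ a b : ℂ, w = a • y₁ + b • y₂})
    -- a general point of Y lies on a unique secant line ⟨y₁,y₂⟩
    (huniq : ∃ q : MvPolynomial (Fin (N + 1)) ℂ,
      (∃ y : Fin (N + 1) → ℂ, eval y F = 0 ∧ eval y q ≠ 0) ∧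
      ∀ y : Fin (N + 1) → ℂ, eval y F = 0 → eval y q ≠ 0 →
        ∀ y₁ ∈ Y₁, ∀ y₂ ∈ Y₂, ∀ y₁' ∈ Y₁, ∀ y₂' ∈ Y₂,
          y₁ ≠ 0 → y₂ ≠ 0 → y₁' ≠ 0 → y₂' ≠ 0 →
          y ∈ Submodule.span ℂ {y₁, y₂} → y ∈ Submodule.span ℂ {y₁', y₂'} →
          (∃ c : ℂ, y₁' = c • y₁) ∧ ∃ c : ℂ, y₂' = c • y₂) :
    False := by
  have hc₁ := hY₁irr.smul_mem_of_maximal (zclosed_singular F) (smul_mem_singular hFhom)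
    hY₁sub hY₁max
  have hc₂ := hY₂irr.smul_mem_of_maximal (zclosed_singular F) (smul_mem_singular hFhom)
    hY₂sub hY₂max
  have hn₁ := exists_ne_zero_of_adim hd₁
  have hn₂ := exists_ne_zero_of_adim hd₂
  have hdvd := eval_add_eq_zero_iff_dvd hFirr hc₁ hc₂ hjoin
  obtain ⟨q, ⟨y₀, hFy₀, hqy₀⟩, huniq⟩ := huniq
  have hq : ∃ a ∈ Y₁, ∃ b ∈ Y₂, eval (a + b) q ≠ 0 := by
    by_contra! h
    obtain ⟨g, rfl⟩ := (hdvd q).1 h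
    exact hqy₀ (by rw [map_mul, hFy₀, zero_mul])
  have hmemspan : ∀ a b : Fin (N + 1) → ℂ, a + b ∈ Submodule.span ℂ {a, b} := fun a b =>
    add_mem (Submodule.subset_span (by simp)) (Submodule.subset_span (by simp))
  have huniq' : ∀ a ∈ Y₁, ∀ b ∈ Y₂, ∀ a' ∈ Y₁, ∀ b' ∈ Y₂, a ≠ 0 → b ≠ 0 → a' ≠ 0 → b' ≠ 0 →
      a + b = a' + b' → eval (a + b) q ≠ 0 → a = a' := by
    intro a ha b hb a' ha' b' hb' ha0 hb0 ha0' hb0' hab hqab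
    obtain ⟨⟨c, rfl⟩, c', rfl⟩ := huniq (a + b) ((hdvd F).2 dvd_rfl a ha b hb) hqab a ha b hb
      a' ha' b' hb' ha0 hb0 ha0' hb0' (hmemspan a b) (hab ▸ hmemspan a' b')
    exact eq_of_add_eq_add hdisj hc₁ hc₂ ha hb hab
  obtain ⟨K, _, _, y, z, hgen, htop⟩ := exists_generic_point hY₁irr hY₂irr
  have hgy : ∀ p, aeval y p = 0 ↔ ∀ a ∈ Y₁, eval a p = 0 := fun p =>
    ⟨fun h a ha => by
      obtain ⟨b, hb, -⟩ := hn₂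
      have := (hgen (rename Sum.inl p)).1 (by rwa [aeval_rename]) a ha b hb
      rwa [eval_rename] at this, aeval_left_eq_zero hgen p⟩
  have hgz : ∀ p, aeval z p = 0 ↔ ∀ b ∈ Y₂, eval b p = 0 := fun p =>
    ⟨fun h b hb => by
      obtain ⟨a, ha, -⟩ := hn₁
      have := (hgen (rename Sum.inr p)).1 (by rwa [aeval_rename]) a ha b hb
      rwa [eval_rename] at this, aeval_right_eq_zero hgen p⟩
  have hw : ∀ g, aeval (fun i => y i + z i) g = 0 ↔ F ∣ g := by
    intro g
    have hg := hgen (aeval (fun j => (X (Sum.inl j) + X (Sum.inr j) :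
      MvPolynomial (Fin (N + 1) ⊕ Fin (N + 1)) ℂ)) g)
    simp only [← MvPolynomial.aeval_eq_eval, MvPolynomial.comp_aeval_apply, map_add, aeval_X,
      Sum.elim_inl, Sum.elim_inr] at hg
    rw [hg, ← hdvd]
    simp only [MvPolynomial.aeval_eq_eval]
    rfl
  obtain ⟨m, hm⟩ := exists_pow_succ_le_of_disjoint hY₁closed hY₂closed hdisj hc₁ hc₂
    (fun p => (hgy p).2) (fun p => (hgz p).2)
  have hfg : (Submodule.span ℂ (insert 1 (Set.range y ∪ Set.range z))).FG :=
    Submodule.fg_span (((Set.finite_range y).union (Set.finite_range z)).insert 1)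
  have halg : Algebra.IsAlgebraic
      (IntermediateField.adjoin ℂ (Set.range fun i => y i + z i)) K := by
    refine isAlgebraic_intermediateField_adjoin htop fun x hx => ?_
    refine (isIntegral_of_pow_le hfg (Submodule.subset_span (Set.mem_insert _ _)) hm
      (Submodule.subset_span (Set.mem_insert_of_mem _ hx)) _ ?_).isAlgebraic
    have : Submodule.span ℂ (insert 1 (Set.range fun i => y i + z i)) ≤
        (Algebra.adjoin ℂ (Set.range fun i => y i + z i)).toSubmodule :=
      Submodule.span_le.2 (Set.insert_subset
        (one_mem (Algebra.adjoin ℂ (Set.range fun i => y i + z i))) Algebra.subset_adjoin)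
    exact this
  have hyL := mem_adjoin_of_unique_decomposition hY₁closed hY₂closed hn₁ hn₂ q hq huniq' hgen halg
  have hzero : ∀ {Y : Set (Fin (N + 1) → ℂ)}, (∀ a ∈ Y, ∀ t : ℂ, t • a ∈ Y) →
      (∃ a ∈ Y, a ≠ 0) → 0 ∈ Y := fun hc ⟨a, ha, _⟩ => by
    simpa using hc a ha 0
  obtain ⟨D₁, s, hsy, hs, hys, hlin | ⟨x, hxy, hx⟩⟩ := exists_algebraicIndependent_linear y
  · exact hnotcone (exists_vertex_of_add_mem (add_mem_of_generic_mem_span hY₁closed hgy hs hsy hlin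
      (hzero hc₁ hn₁)) hc₁ hn₁ hjoin)
  obtain ⟨D₂, t, htz, ht, hzt, hlin | ⟨x', hxz, hx'⟩⟩ := exists_algebraicIndependent_linear z
  · refine hnotcone (exists_vertex_of_add_mem (Y₂ := Y₁) (add_mem_of_generic_mem_span hY₂closed hgz
      ht htz hlin (hzero hc₂ hn₂)) hc₂ hn₂ (hjoin.trans (congrArg zcl (Set.ext fun w => ?_))))
    constructor <;> rintro ⟨a, ha, b, hb, c, c', rfl⟩ <;>
      exact ⟨b, hb, a, ha, c', c, add_comm _ _⟩
  exact not_exists_generic_pair hFirr hFhom.totalDegree_le hgen htop hw hm hyL hsy htz hs ht hys hzt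
    hxy hxz hx hx'
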